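/- arXiv:1906.09783 — 3 statements merged into one kernel-verified Lean document; each statement's English description precedes it below -/
import Mathlib

section
/- There exists a universal constant c > 0 such that for every weighted graph G = (V, E, w) that excludes the complete graph K_r as a minor (r ≥ 2) and every Δ > 0, G admits a strongly (c · r, Δ)-separating decomposition: a probability distribution D over partitions of V such that every partition in the support of D is strongly Δ-bounded and for every pair u, v ∈ V, Pr_{P∼D}[P(u) ≠ P(v)] ≤ c · r · d_G(u, v)/Δ. -/
open MeasureTheory

namespace Pad

variable {V : Type*}

/-- The weight of a walk: the sum of the weights of its edges. -/
def walkWeight (w : Sym2 V → ℝ) {G : SimpleGraph V} {u v : V} (p : G.Walk u v) : ℝ :=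
  (p.darts.map fun d => w d.edge).sum

/-- Shortest-path distance in the weighted graph `(G, w)`. -/
noncomputable def wdist (w : Sym2 V → ℝ) (G : SimpleGraph V) (u v : V) : ℝ :=
  sInf {x | ∃ p : G.Walk u v, x = walkWeight w p}

/-- Distance from a vertex to a set of vertices. -/
noncomputable def wdistSet (w : Sym2 V → ℝ) (G : SimpleGraph V) (v : V) (A : Set V) : ℝ :=
  sInf {x | ∃ a ∈ A, x = wdist w G v a}

/-- The closed ball of radius `r` around `v`. -/
def ball (w : Sym2 V → ℝ) (G : SimpleGraph V) (v : V) (r : ℝ) : Set V :=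
  {u | wdist w G v u ≤ r}

/-- Weight of a walk of an induced subgraph, measured with the weights of `G`. -/
def walkWeightI (w : Sym2 V → ℝ) {G : SimpleGraph V} {C : Set V} {u v : C}
    (p : (G.induce C).Walk u v) : ℝ :=
  (p.darts.map fun d => w (Sym2.map Subtype.val d.edge)).sum

/-- The cluster `C` has strong diameter at most `Δ`: every two vertices of `C` are joined,
inside the induced subgraph `G[C]`, by a walk of weight at most `Δ`. -/
def StronglyBounded (w : Sym2 V → ℝ) (G : SimpleGraph V) (C : Set V) (Δ : ℝ) : Prop :=
  ∀ u v : C, ∃ p : (G.induce C).Walk u v, walkWeightI w p ≤ Δ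

/-- A partition of `V`, given by the map `cl` sending a vertex to its cluster. -/
structure Partition (V : Type*) where
  cl : V → Set V
  mem_cl : ∀ v, v ∈ cl v
  cl_eq : ∀ u v, u ∈ cl v → cl u = cl v

/-- A partition is strongly `Δ`-bounded if each of its clusters has strong diameter at most `Δ`. -/
def Partition.StronglyBounded (w : Sym2 V → ℝ) (G : SimpleGraph V) (P : Partition V)
    (Δ : ℝ) : Prop :=
  ∀ v : V, Pad.StronglyBounded w G (P.cl v) Δ

/-- `(G, w)` has doubling dimension `ddim`: every ball of radius `2r` can be covered by
`2 ^ ddim` balls of radius `r`. -/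
def Doubling (w : Sym2 V → ℝ) (G : SimpleGraph V) (ddim : ℝ) : Prop :=
  ∀ (x : V) (r : ℝ), 0 < r → ∃ T : Set V, T.Finite ∧ ((T.ncard : ℝ) ≤ (2 : ℝ) ^ ddim) ∧
    ball w G x (2 * r) ⊆ ⋃ y ∈ T, ball w G y r

/-- `G` has the complete graph `K_r` as a minor: there are `r` pairwise disjoint connected
branch sets with an edge of `G` between any two of them. -/
def HasCliqueMinor (G : SimpleGraph V) (r : ℕ) : Prop :=
  ∃ B : Fin r → Set V,
    (∀ i, (G.induce (B i)).Connected) ∧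
    (Pairwise fun i j => Disjoint (B i) (B j)) ∧
    ∀ i j : Fin r, i ≠ j → ∃ u ∈ B i, ∃ v ∈ B j, G.Adj u v

/-- A shortest path: a path whose weight equals the distance between its endpoints. -/
def IsShortestPath (w : Sym2 V → ℝ) (G : SimpleGraph V) {u v : V} (p : G.Walk u v) : Prop :=
  p.IsPath ∧ walkWeight w p = wdist w G u v

/-- `G` has an `r`-core with radius `Δ`: there are at most `r` shortest paths such that every
vertex is within distance `Δ` of their union. -/
def HasCore (w : Sym2 V → ℝ) (G : SimpleGraph V) (r : ℕ) (Δ : ℝ) : Prop :=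
  ∃ r' : ℕ, r' ≤ r ∧ ∃ (a b : Fin r' → V) (p : ∀ i, G.Walk (a i) (b i)),
    (∀ i, IsShortestPath w G (p i)) ∧
    ∀ v : V, ∃ i, ∃ u ∈ (p i).support, wdist w G v u ≤ Δ

end Pad

namespace MinorFree

variable {V : Type}

/-- `Wk G W U x y n`: there is a walk from `x` to `y` inside `U` of total weight exactly `n`. -/
inductive Wk (G : SimpleGraph V) (W : V → V → ℕ) (U : Set V) : V → V → ℕ → Prop
  | nil {x : V} : x ∈ U → Wk G W U x x 0
  | cons {x y z : V} {n : ℕ} : x ∈ U → G.Adj x y → Wk G W U y z n → Wk G W U x z (W x y + n)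

/-- `Wn G W U x y n`: there is a walk from `x` to `y` inside `U` of total weight at most `n`. -/
def Wn (G : SimpleGraph V) (W : V → V → ℕ) (U : Set V) (x y : V) (n : ℕ) : Prop :=
  ∃ m ≤ n, Wk G W U x y m

/-- Vertices that reach `T` inside `U` by a walk of weight at most `R`. -/
def nbhd (G : SimpleGraph V) (W : V → V → ℕ) (U T : Set V) (R : ℕ) : Set V :=
  {x | ∃ t ∈ T, Wn G W U x t R}

/-- `U` is nonempty and connected in `G`. -/
def Conn (G : SimpleGraph V) (W : V → V → ℕ) (U : Set V) : Prop :=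
  U.Nonempty ∧ ∀ x ∈ U, ∀ y ∈ U, ∃ n, Wk G W U x y n

/-- The vertex `q` has a neighbour in `X`. -/
def Touch (G : SimpleGraph V) (q : V) (X : Set V) : Prop := ∃ x ∈ X, G.Adj q x

/-- `v` reaches a vertex adjacent to `X` by a walk inside `U` of weight at most `s`. -/
def Cert (G : SimpleGraph V) (W : V → V → ℕ) (U X : Set V) (v : V) (s : ℕ) : Prop :=
  ∃ q, Wn G W U v q s ∧ Touch G q X

variable {G : SimpleGraph V} {W : V → V → ℕ} {U U' T X : Set V} {x y z v : V} {n m R s : ℕ}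

lemma Wk.left_mem (h : Wk G W U x y n) : x ∈ U := by cases h <;> assumption

lemma Wk.right_mem (h : Wk G W U x y n) : y ∈ U := by
  induction h with
  | nil h => exact h
  | cons _ _ _ ih => exact ih

lemma Wk.mono (hU : U ⊆ U') (h : Wk G W U x y n) : Wk G W U' x y n := by
  induction h with
  | nil h => exact .nil (hU h)
  | cons h1 h2 _ ih => exact .cons (hU h1) h2 ih

lemma Wk.trans (h : Wk G W U x y n) (h' : Wk G W U y z m) : Wk G W U x z (n + m) := by
  induction h with
  | nil _ => simpa using h'
  | cons h1 h2 _ ih => rw [add_assoc]; exact .cons h1 h2 (ih h')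

lemma Wk.edge (hx : x ∈ U) (hy : y ∈ U) (h : G.Adj x y) : Wk G W U x y (W x y) :=
  .cons hx h (.nil hy)

lemma Wk.symm (hW : ∀ x y, W x y = W y x) (h : Wk G W U x y n) : Wk G W U y x n := by
  induction h with
  | nil h => exact .nil h
  | cons h1 h2 h3 ih =>
    rw [add_comm, hW]
    exact ih.trans (.edge h3.left_mem h1 h2.symm)

lemma Wk.wn (h : Wk G W U x y n) : Wn G W U x y n := ⟨n, le_rfl, h⟩

lemma Wn.left_mem (h : Wn G W U x y n) : x ∈ U := by
  obtain ⟨_, _, h⟩ := h; exact h.left_mem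

lemma Wn.le (h : Wn G W U x y n) (hn : n ≤ m) : Wn G W U x y m := by
  obtain ⟨k, hk, h⟩ := h; exact ⟨k, hk.trans hn, h⟩

lemma Wn.mono (hU : U ⊆ U') (h : Wn G W U x y n) : Wn G W U' x y n := by
  obtain ⟨k, hk, h⟩ := h; exact ⟨k, hk, h.mono hU⟩

lemma Wn.trans (h : Wn G W U x y n) (h' : Wn G W U y z m) : Wn G W U x z (n + m) := by
  obtain ⟨k, hk, h⟩ := h
  obtain ⟨l, hl, h'⟩ := h'
  exact ⟨k + l, add_le_add hk hl, h.trans h'⟩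

lemma Wn.symm (hW : ∀ x y, W x y = W y x) (h : Wn G W U x y n) : Wn G W U y x n := by
  obtain ⟨k, hk, h⟩ := h; exact ⟨k, hk, h.symm hW⟩

lemma nbhd_subset : nbhd G W U T R ⊆ U := by
  rintro x ⟨t, _, h⟩; exact h.left_mem

lemma subset_nbhd (hT : T ⊆ U) : T ⊆ nbhd G W U T R :=
  fun t ht => ⟨t, ht, 0, Nat.zero_le _, .nil (hT ht)⟩

lemma nbhd_mono (h : n ≤ m) : nbhd G W U T n ⊆ nbhd G W U T m := by
  rintro x ⟨t, ht, hx⟩; exact ⟨t, ht, hx.le h⟩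

lemma nbhd_adj (hx : x ∈ U) (h : G.Adj x y) (hy : y ∈ nbhd G W U T n) :
    x ∈ nbhd G W U T (W x y + n) := by
  obtain ⟨t, ht, hy⟩ := hy
  exact ⟨t, ht, (Wk.edge hx hy.left_mem h).wn.trans hy⟩

lemma Wk.in_nbhd {t : V} (h : Wk G W U x t n) (ht : t ∈ T) (hn : n ≤ R) :
    Wk G W (nbhd G W U T R) x t n := by
  induction h with
  | nil h => exact .nil ⟨_, ht, 0, Nat.zero_le _, .nil h⟩
  | cons h1 h2 h3 ih =>
    exact .cons ⟨_, ht, _, hn, .cons h1 h2 h3⟩ h2 (ih ht (by omega))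

/-- A walk towards `T` starting outside a neighbourhood of `T` reaches its boundary early. -/
lemma Wk.cert_nbhd {t : V} (h : Wk G W U v t n) (ht : t ∈ T) (hv : v ∉ nbhd G W U T R) :
    Cert G W (U \ nbhd G W U T R) (nbhd G W U T R) v (n - R) := by
  induction h with
  | nil h => exact absurd ⟨_, ht, 0, Nat.zero_le _, .nil h⟩ hv
  | @cons x y z n h1 h2 h3 ih =>
    by_cases hy : y ∈ nbhd G W U T R
    · exact ⟨x, ⟨0, Nat.zero_le _, .nil ⟨h1, hv⟩⟩, y, hy, h2⟩
    · obtain ⟨q, ⟨k, hk, hq⟩, hqt⟩ := ih ht hy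
      have hR : R < n := by
        by_contra hR
        exact hy ⟨_, ht, n, by omega, h3⟩
      exact ⟨q, ⟨W x y + k, by omega, .cons ⟨h1, hv⟩ h2 hq⟩, hqt⟩

/-- Either a walk avoids `B`, or some vertex of `B` is met early. -/
lemma Wk.avoid_or {B : Set V} {q : V} (h : Wk G W U v q n) :
    Wk G W (U \ B) v q n ∨ ∃ p ∈ B, Wn G W U v p n := by
  induction h with
  | @nil x h =>
    by_cases hx : x ∈ B
    · exact .inr ⟨x, hx, (Wk.nil h).wn⟩
    · exact .inl (.nil ⟨h, hx⟩)
  | @cons x y z n h1 h2 h3 ih =>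
    by_cases hx : x ∈ B
    · exact .inr ⟨x, hx, 0, Nat.zero_le _, .nil h1⟩
    · rcases ih with ih | ⟨p, hp, hyp⟩
      · exact .inl (.cons ⟨h1, hx⟩ h2 ih)
      · exact .inr ⟨p, hp, (Wk.edge h1 h3.left_mem h2).wn.trans hyp⟩

lemma Cert.of_not (h : Cert G W U X v s)
    (h' : ¬ Cert G W (U \ nbhd G W U T R) X v s) : v ∈ nbhd G W U T (s + R) := by
  obtain ⟨q, ⟨k, hk, hq⟩, hqX⟩ := h
  rcases hq.avoid_or (B := nbhd G W U T R) with h1 | ⟨p, ⟨t, ht, hp⟩, hvp⟩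
  · exact absurd ⟨q, ⟨k, hk, h1⟩, hqX⟩ h'
  · exact ⟨t, ht, (hvp.le hk).trans hp⟩

lemma Cert.mono (hU : U ⊆ U') (h : Cert G W U X v s) : Cert G W U' X v s := by
  obtain ⟨q, hq, hX⟩ := h
  exact ⟨q, hq.mono hU, hX⟩

lemma Wk.le_of_lip {φ : V → ℕ} (hφ : ∀ a ∈ U, ∀ b ∈ U, G.Adj a b → φ b ≤ φ a + W a b)
    (h : Wk G W U x y n) : φ y ≤ φ x + n := by
  induction h with
  | nil _ => simp
  | cons h1 h2 h3 ih =>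
    have := hφ _ h1 _ h3.left_mem h2
    omega

/-- The vertex set of a walk along which `φ` increases as fast as possible. -/
lemma Wk.exists_geodesic (hW : ∀ x y, W x y = W y x) {φ : V → ℕ}
    (hφ : ∀ a ∈ U, ∀ b ∈ U, G.Adj a b → φ b ≤ φ a + W a b)
    (h : Wk G W U x y n) (he : φ x + n = φ y) :
    ∃ P ⊆ U, x ∈ P ∧ y ∈ P ∧ (∀ a ∈ P, φ x ≤ φ a) ∧
      ∀ a ∈ P, ∀ b ∈ P, φ a ≤ φ b → Wn G W P a b (φ b - φ a) := by
  induction h with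
  | @nil x h =>
    refine ⟨{x}, by simpa using h, rfl, rfl, by simp, ?_⟩
    rintro a rfl b rfl _
    exact ⟨0, Nat.zero_le _, .nil rfl⟩
  | @cons x y z n h1 h2 h3 ih =>
    have e1 := hφ _ h1 _ h3.left_mem h2
    have e2 := h3.le_of_lip hφ
    obtain ⟨P, hPU, hyP, hzP, hmin, hP⟩ := ih (by omega)
    have hsub : P ⊆ insert x P := Set.subset_insert _ _
    have hx : ∀ b ∈ P, Wn G W (insert x P) x b (φ b - φ x) := by
      intro b hb
      have := hmin b hb
      exact ((Wk.edge (Set.mem_insert x P) (hsub hyP) h2).wn.trans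
        ((hP y hyP b hb this).mono hsub)).le (by omega)
    refine ⟨insert x P, Set.insert_subset h1 hPU, Set.mem_insert _ _, hsub hzP, ?_, ?_⟩
    · rintro a (rfl | ha)
      · exact le_rfl
      · have := hmin a ha; omega
    · rintro a (rfl | ha) b (rfl | hb) hab
      · exact ⟨0, Nat.zero_le _, .nil (Set.mem_insert _ _)⟩
      · exact hx b hb
      · exact ((hx a ha).symm hW).le (by have := hmin a ha; omega)
      · exact (hP a ha b hb hab).mono hsub

/-- The least weight of a walk from `x` to `y` inside `U`. -/
noncomputable def dst (G : SimpleGraph V) (W : V → V → ℕ) (U : Set V) (x y : V) : ℕ :=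
  sInf {n | Wk G W U x y n}

lemma dst_le (h : Wn G W U x y n) : dst G W U x y ≤ n := by
  obtain ⟨m, hm, h⟩ := h
  exact (Nat.sInf_le h).trans hm

lemma Wk.dst (h : Wk G W U x y n) : Wk G W U x y (dst G W U x y) :=
  Nat.sInf_mem (s := {n | Wk G W U x y n}) ⟨n, h⟩

lemma dst_lip (h : ∃ n, Wk G W U x y n) (hz : z ∈ U) (ha : G.Adj y z) :
    MinorFree.dst G W U x z ≤ MinorFree.dst G W U x y + W y z := by
  obtain ⟨n, h⟩ := h
  exact dst_le (h.dst.trans (.edge h.right_mem hz ha)).wn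

/-- Neighbourhoods of a connected core are connected. -/
lemma conn_nbhd (hW : ∀ x y, W x y = W y x) {t₀ : V} (ht₀ : t₀ ∈ T) (hTU : T ⊆ U)
    (hT : ∀ t ∈ T, ∃ n, Wk G W T t₀ t n) : Conn G W (nbhd G W U T R) := by
  have key : ∀ x ∈ nbhd G W U T R, ∃ n, Wk G W (nbhd G W U T R) t₀ x n := by
    rintro x ⟨t, ht, m, hm, hx⟩
    obtain ⟨k, hk⟩ := hT t ht
    exact ⟨_, (hk.mono (subset_nbhd hTU)).trans ((hx.in_nbhd ht hm).symm hW)⟩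
  refine ⟨⟨t₀, subset_nbhd hTU ht₀⟩, fun x hx y hy => ?_⟩
  obtain ⟨a, ha⟩ := key x hx
  obtain ⟨b, hb⟩ := key y hy
  exact ⟨_, (ha.symm hW).trans hb⟩

end MinorFree

namespace MinorFree

variable {V : Type} {G : SimpleGraph V} {W : V → V → ℕ} {U X T : Set V} {v : V}

lemma Wk.reachable {C : Set V} {x y : V} {n : ℕ} (h : Wk G W C x y n) :
    (G.induce C).Reachable ⟨x, h.left_mem⟩ ⟨y, h.right_mem⟩ := by
  induction h with
  | nil _ => exact .refl _
  | @cons x y z n h1 h2 h3 ih =>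
    have : (G.induce C).Adj ⟨x, h1⟩ ⟨y, h3.left_mem⟩ := h2
    exact this.reachable.trans ih

lemma Conn.induce_connected {C : Set V} (h : Conn G W C) : (G.induce C).Connected := by
  obtain ⟨⟨x, hx⟩, h⟩ := h
  refine { preconnected := ?_, nonempty := ⟨⟨x, hx⟩⟩ }
  rintro ⟨a, ha⟩ ⟨b, hb⟩
  obtain ⟨n, hn⟩ := h a ha b hb
  exact hn.reachable

/-- The state of the carving process: `U` is the set of remaining vertices and `past` the
family of removed supernodes, where supernodes touching a common component of `U` are
pairwise adjacent. -/
structure Inv (G : SimpleGraph V) (W : V → V → ℕ) (U : Set V) (past : Set (Set V)) : Prop where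
  disj : ∀ X ∈ past, Disjoint X U
  conn : ∀ X ∈ past, Conn G W X
  pw : ∀ X ∈ past, ∀ Y ∈ past, X ≠ Y → Disjoint X Y
  adj : ∀ X ∈ past, ∀ Y ∈ past, X ≠ Y → ∀ x y n, Wk G W U x y n →
    Touch G x X → Touch G y Y → ∃ a ∈ X, Touch G a Y

lemma Wk.component {x : V} {n : ℕ} (h : Wk G W U v x n) :
    ∃ m, Wk G W {y | ∃ k, Wk G W U v y k} v x m := by
  suffices H : ∀ {a x n}, Wk G W U a x n → (∃ k, Wk G W U v a k) →
      ∃ m, Wk G W {y | ∃ k, Wk G W U v y k} a x m from H h ⟨0, .nil h.left_mem⟩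
  intro a x n h
  induction h with
  | nil _ => exact fun h => ⟨0, .nil h⟩
  | @cons a b z n h1 h2 h3 ih =>
    rintro ⟨k, hk⟩
    obtain ⟨m, hm⟩ := ih ⟨_, hk.trans (.edge h1 h3.left_mem h2)⟩
    exact ⟨_, .cons ⟨k, hk⟩ h2 hm⟩

lemma conn_component (hW : ∀ x y, W x y = W y x) (hv : v ∈ U) :
    Conn G W {y | ∃ k, Wk G W U v y k} := by
  refine ⟨⟨v, 0, .nil hv⟩, ?_⟩
  rintro x ⟨a, ha⟩ y ⟨b, hb⟩
  obtain ⟨m, hm⟩ := ha.component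
  obtain ⟨k, hk⟩ := hb.component
  exact ⟨_, (hm.symm hW).trans hk⟩

lemma Inv.card_lt {past : Set (Set V)} {r : ℕ} (hW : ∀ x y, W x y = W y x)
    (hI : Inv G W U past) (hr : ¬ Pad.HasCliqueMinor G r) (hv : v ∈ U) (K : Finset (Set V))
    (hK : ∀ X ∈ K, X ∈ past ∧ ∃ s, Cert G W U X v s) : K.card + 1 < r := by
  by_contra hcon
  apply hr
  obtain _ | r' := r
  · exact ⟨fun i => i.elim0, fun i => i.elim0, fun i => i.elim0, fun i => i.elim0⟩
  have hle : Fintype.card (Fin r') ≤ Fintype.card K := by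
    simp only [Fintype.card_fin, Fintype.card_coe]; omega
  obtain ⟨e⟩ := Function.Embedding.nonempty_of_card_le hle
  set C : Set V := {y | ∃ k, Wk G W U v y k} with hC
  have hCU : C ⊆ U := by rintro y ⟨k, hk⟩; exact hk.right_mem
  have hp : ∀ i, (e i : Set V) ∈ past := fun i => (hK _ (e i).2).1
  have ht : ∀ i, ∃ q, (∃ k, Wk G W U v q k) ∧ Touch G q (e i : Set V) := by
    intro i
    obtain ⟨s, q, ⟨k, _, hk⟩, hq⟩ := (hK _ (e i).2).2
    exact ⟨q, ⟨k, hk⟩, hq⟩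
  have hne : ∀ i j, i ≠ j → (e i : Set V) ≠ e j := fun i j hij h =>
    hij (e.injective (Subtype.ext h))
  refine ⟨Fin.cons C fun i => (e i : Set V), ?_, ?_, ?_⟩
  · intro i
    refine Fin.cases ?_ (fun i => ?_) i
    · exact (conn_component hW hv).induce_connected
    · exact (hI.conn _ (hp i)).induce_connected
  · intro i j
    refine Fin.cases ?_ (fun i => ?_) i <;> refine Fin.cases ?_ (fun j => ?_) j
    · exact fun h => absurd rfl h
    · exact fun _ => ((hI.disj _ (hp j)).mono_right hCU).symm
    · exact fun _ => (hI.disj _ (hp i)).mono_right hCU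
    · exact fun h => hI.pw _ (hp i) _ (hp j) (hne i j fun h' => h (by rw [h']))
  · intro i j
    refine Fin.cases ?_ (fun i => ?_) i <;> refine Fin.cases ?_ (fun j => ?_) j
    · exact fun h => absurd rfl h
    · intro _
      obtain ⟨q, hq, x, hx, hqx⟩ := ht j
      exact ⟨q, hq, x, hx, hqx⟩
    · intro _
      obtain ⟨q, hq, x, hx, hqx⟩ := ht i
      exact ⟨x, hx, q, hq, hqx.symm⟩
    · intro h
      obtain ⟨q, ⟨k, hk⟩, hq⟩ := ht i
      obtain ⟨q', ⟨k', hk'⟩, hq'⟩ := ht j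
      exact hI.adj _ (hp i) _ (hp j) (hne i j fun h' => h (by rw [h'])) q q' _
        ((hk.symm hW).trans hk') hq hq'

lemma Inv.step {past : Set (Set V)} (hW : ∀ x y, W x y = W y x)
    (hI : Inv G W U past) {t₀ : V} (ht₀ : t₀ ∈ T) (hTU : T ⊆ U)
    (hT : ∀ t ∈ T, ∃ n, Wk G W T t₀ t n)
    (htouch : ∀ X ∈ past, (∃ s, Cert G W U X t₀ s) → ∃ q ∈ T, Touch G q X) (R : ℕ) :
    Inv G W (U \ nbhd G W U T R) (insert (nbhd G W U T R) past) := by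
  set B := nbhd G W U T R with hB
  have hBU : B ⊆ U := nbhd_subset
  have hTB : T ⊆ B := subset_nbhd hTU
  have hBc : Conn G W B := conn_nbhd hW ht₀ hTU hT
  have hsub : U \ B ⊆ U := Set.sdiff_subset
  have key : ∀ Y ∈ past, ∀ x y n, Wk G W (U \ B) x y n → Touch G x B → Touch G y Y →
      ∃ a ∈ B, Touch G a Y := by
    rintro Y hY x y n hxy ⟨b, hb, hxb⟩ hyY
    obtain ⟨m, hm⟩ := hBc.2 t₀ (hTB ht₀) b hb
    have h1 : Wk G W U t₀ y _ := ((hm.mono hBU).trans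
      (.edge (hBU hb) (hsub hxy.left_mem) hxb.symm)).trans (hxy.mono hsub)
    obtain ⟨q, hq, hqY⟩ := htouch Y hY ⟨_, y, h1.wn, hyY⟩
    exact ⟨q, hTB hq, hqY⟩
  refine ⟨?_, ?_, ?_, ?_⟩
  · rintro Y (rfl | hY)
    · exact Set.disjoint_sdiff_right
    · exact (hI.disj Y hY).mono_right hsub
  · rintro Y (rfl | hY)
    · exact hBc
    · exact hI.conn Y hY
  · rintro Y (rfl | hY) Z (rfl | hZ) hYZ
    · exact absurd rfl hYZ
    · exact ((hI.disj Z hZ).mono_right hBU).symm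
    · exact (hI.disj Y hY).mono_right hBU
    · exact hI.pw Y hY Z hZ hYZ
  · rintro Y (rfl | hY) Z (rfl | hZ) hYZ x y n hxy hxY hyZ
    · exact absurd rfl hYZ
    · exact key Z hZ x y n hxy hxY hyZ
    · obtain ⟨a, ha, b, hb, hab⟩ := key Y hY y x n (hxy.symm hW) hyZ hxY
      exact ⟨b, hb, a, ha, hab.symm⟩
    · exact hI.adj Y hY Z hZ hYZ x y n (hxy.mono hsub) hxY hyZ

/-- `f` partitions `U` into clusters of strong diameter at most `D`. -/
def Good (G : SimpleGraph V) (W : V → V → ℕ) (U : Set V) (D : ℕ) (f : V → Set V) : Prop :=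
  ∀ v ∈ U, v ∈ f v ∧ f v ⊆ U ∧ (∀ u ∈ f v, f u = f v) ∧ ∀ x ∈ f v, ∀ y ∈ f v, Wn G W (f v) x y D

open Classical in
/-- A random partition of `U` with strong diameter at most `D` in which every edge `uv` is cut
with probability at most `b u v`. -/
def HasDecomp (G : SimpleGraph V) (W : V → V → ℕ) (U : Set V) (D : ℕ) (b : V → V → ℝ) : Prop :=
  ∃ (Ω : Type) (_ : Fintype Ω) (p : Ω → ℝ) (f : Ω → V → Set V),
    (∀ ω, 0 ≤ p ω) ∧ ∑ ω, p ω = 1 ∧ (∀ ω, Good G W U D (f ω)) ∧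
    ∀ u ∈ U, ∀ v ∈ U, G.Adj u v → ∑ ω, (if f ω u ≠ f ω v then p ω else 0) ≤ b u v

lemma HasDecomp.mix {ι : Type} [Fintype ι] {D : ℕ} {q : ι → ℝ} (hq : ∀ i, 0 ≤ q i)
    (hq1 : ∑ i, q i = 1) {b : ι → V → V → ℝ} (h : ∀ i, HasDecomp G W U D (b i)) :
    HasDecomp G W U D fun u v => ∑ i, q i * b i u v := by
  choose Ω hΩ p f hp hp1 hg hb using h
  refine ⟨Σ i, Ω i, inferInstance, fun ω => q ω.1 * p ω.1 ω.2, fun ω => f ω.1 ω.2,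
    fun ω => mul_nonneg (hq _) (hp _ _), ?_, fun ω => hg _ _, ?_⟩
  · simp_rw [Fintype.sum_sigma, ← Finset.mul_sum, hp1, mul_one, hq1]
  · intro u hu v hv huv
    rw [Fintype.sum_sigma]
    refine Finset.sum_le_sum fun i _ => ?_
    refine le_trans (le_of_eq ?_) (mul_le_mul_of_nonneg_left (hb i u hu v hv huv) (hq i))
    rw [Finset.mul_sum]
    exact Finset.sum_congr rfl fun ω _ => by split_ifs <;> simp

open Classical in
lemma HasDecomp.glue {D : ℕ} {b₁ b₂ : V → V → ℝ} (hX : X ⊆ U) (h₁ : HasDecomp G W X D b₁)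
    (h₂ : HasDecomp G W (U \ X) D b₂) :
    HasDecomp G W U D fun u v =>
      if u ∈ X ∧ v ∈ X then b₁ u v else if u ∉ X ∧ v ∉ X then b₂ u v else 1 := by
  obtain ⟨Ω₁, _, p₁, f₁, hp₁, hs₁, hg₁, hb₁⟩ := h₁
  obtain ⟨Ω₂, _, p₂, f₂, hp₂, hs₂, hg₂, hb₂⟩ := h₂
  have hprod : ∑ ω : Ω₁ × Ω₂, p₁ ω.1 * p₂ ω.2 = 1 := by
    rw [Fintype.sum_prod_type]
    simp_rw [← Finset.mul_sum, hs₂, mul_one, hs₁]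
  refine ⟨Ω₁ × Ω₂, inferInstance, fun ω => p₁ ω.1 * p₂ ω.2,
    fun ω v => if v ∈ X then f₁ ω.1 v else f₂ ω.2 v,
    fun ω => mul_nonneg (hp₁ _) (hp₂ _), hprod, ?_, ?_⟩
  · intro ω v hv
    by_cases hvX : v ∈ X
    · obtain ⟨h1, h2, h3, h4⟩ := hg₁ ω.1 v hvX
      simp only [hvX, if_true]
      exact ⟨h1, h2.trans hX, fun u hu => by simp only [h2 hu, if_true, h3 u hu], h4⟩
    · obtain ⟨h1, h2, h3, h4⟩ := hg₂ ω.2 v ⟨hv, hvX⟩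
      simp only [hvX, if_false]
      exact ⟨h1, h2.trans Set.sdiff_subset,
        fun u hu => by simp only [(h2 hu).2, if_false, h3 u hu], h4⟩
  · intro u hu v hv huv
    by_cases h1 : u ∈ X ∧ v ∈ X
    · simp only [h1, if_true, and_self]
      refine le_trans (le_of_eq ?_) (hb₁ u h1.1 v h1.2 huv)
      rw [Fintype.sum_prod_type]
      refine Finset.sum_congr rfl fun ω _ => ?_
      split_ifs
      · simp only [← Finset.mul_sum, hs₂, mul_one]
      · simp
    by_cases h2 : u ∉ X ∧ v ∉ X
    · simp only [h2, if_false, and_self, not_false_eq_true, if_true]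
      refine le_trans (le_of_eq ?_) (hb₂ u ⟨hu, h2.1⟩ v ⟨hv, h2.2⟩ huv)
      rw [Fintype.sum_prod_type_right]
      refine Finset.sum_congr rfl fun ω _ => ?_
      split_ifs
      · simp only [← Finset.sum_mul, hs₁, one_mul]
      · simp
    · dsimp only
      rw [if_neg h1, if_neg h2, ← hprod]
      refine Finset.sum_le_sum fun ω _ => ?_
      split_ifs <;> first | exact le_rfl | exact mul_nonneg (hp₁ _) (hp₂ _)

lemma HasDecomp.mono {D : ℕ} {b b' : V → V → ℝ} (h : HasDecomp G W U D b)
    (hb : ∀ u ∈ U, ∀ v ∈ U, G.Adj u v → b u v ≤ b' u v) : HasDecomp G W U D b' := by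
  obtain ⟨Ω, _, p, f, h1, h2, h3, h4⟩ := h
  exact ⟨Ω, _, p, f, h1, h2, h3,
    fun u hu v hv huv => (h4 u hu v hv huv).trans (hb u hu v hv huv)⟩

end MinorFree

namespace MinorFree

/-- Weight of a distance `s`, decaying by `2/3` per unit `Y`. -/
noncomputable def gwt (Y s : ℕ) : ℝ := (2 / 3) ^ (s / Y)

variable {α : Type} {Y : ℕ}

lemma gwt_pos (s : ℕ) : 0 < gwt Y s := by unfold gwt; positivity

lemma gwt_le_one (s : ℕ) : gwt Y s ≤ 1 := pow_le_one₀ (by norm_num) (by norm_num)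

lemma gwt_anti {s t : ℕ} (h : s ≤ t) : gwt Y t ≤ gwt Y s :=
  pow_le_pow_of_le_one (by norm_num) (by norm_num) (Nat.div_le_div_right h)

lemma gwt_add (hY : 0 < Y) (s k : ℕ) : gwt Y (s + k * Y) = (2 / 3) ^ k * gwt Y s := by
  unfold gwt
  rw [Nat.add_mul_div_right _ _ hY, pow_add, mul_comm]

/-- The potential of a list of distances: the `i`-th entry `s` counts `gwt Y s / 8^(i+1)`. -/
noncomputable def pot (Y : ℕ) : List (α × ℕ) → ℝ
  | [] => 0
  | e :: l => (gwt Y e.2 + pot Y l) / 8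

/-- Insert an entry in front of the first entry that is not smaller. -/
def ins (x : α × ℕ) : List (α × ℕ) → List (α × ℕ)
  | [] => [x]
  | e :: l => if x.2 ≤ e.2 then x :: e :: l else e :: ins x l

lemma ins_perm (x : α × ℕ) (l : List (α × ℕ)) : (ins x l).Perm (x :: l) := by
  induction l with
  | nil => exact .refl _
  | cons e l ih =>
    unfold ins
    split_ifs
    · exact .refl _
    · exact (ih.cons e).trans (.swap _ _ _)

lemma ins_sorted {x : α × ℕ} {l : List (α × ℕ)} (hl : l.Pairwise fun a b => a.2 ≤ b.2) :
    (ins x l).Pairwise fun a b => a.2 ≤ b.2 := by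
  induction l with
  | nil => simp [ins]
  | cons e l ih =>
    have hl' := List.pairwise_cons.1 hl
    unfold ins
    split_ifs with h
    · refine List.pairwise_cons.2 ⟨?_, hl⟩
      intro a ha
      rcases List.mem_cons.1 ha with rfl | ha
      · exact h
      · exact h.trans (hl'.1 a ha)
    · refine List.pairwise_cons.2 ⟨?_, ih hl'.2⟩
      intro a ha
      rcases List.mem_cons.1 ((ins_perm x l).mem_iff.1 ha) with rfl | ha
      · omega
      · exact hl'.1 a ha

/-- The potential of a list with entries at most `B` is at most `B/7 (1 - 8^{-k})`. -/
lemma pot_le {B : ℝ} {l : List (α × ℕ)} (h : ∀ e ∈ l, gwt Y e.2 ≤ B) :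
    pot Y l ≤ B / 7 * (1 - (1 / 8) ^ l.length) := by
  induction l with
  | nil => simp [pot]
  | cons e l ih =>
    have h1 := h e (List.mem_cons_self ..)
    have h2 := ih fun a ha => h a (List.mem_cons_of_mem _ ha)
    unfold pot
    rw [List.length_cons, pow_succ]
    linarith

lemma pot_le_seventh {B : ℝ} (hB : 0 ≤ B) {l : List (α × ℕ)} (h : ∀ e ∈ l, gwt Y e.2 ≤ B) :
    pot Y l ≤ B / 7 := by
  have := pot_le h
  have h2 : (0 : ℝ) ≤ B / 7 * (1 / 8) ^ l.length := by positivity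
  linarith

lemma pot_ins (x : α × ℕ) {l : List (α × ℕ)} (hl : l.Pairwise fun a b => a.2 ≤ b.2) :
    pot Y l + (1 / 8) ^ (l.length + 1) * gwt Y x.2 ≤ pot Y (ins x l) := by
  induction l with
  | nil => simp [pot, ins]; linarith
  | cons e l ih =>
    have hl' := List.pairwise_cons.1 hl
    unfold ins
    split_ifs with h
    · have h1 : pot Y (e :: l) ≤ gwt Y x.2 / 7 * (1 - (1 / 8) ^ (e :: l).length) := by
        apply pot_le
        intro a ha
        rcases List.mem_cons.1 ha with rfl | ha
        · exact gwt_anti h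
        · exact gwt_anti (h.trans (hl'.1 a ha))
      rw [pot.eq_2 Y x, pow_succ]
      linarith
    · have := ih hl'.2
      unfold pot
      rw [List.length_cons, pow_succ]
      linarith

open Classical in
/-- The contribution to the potential of the first entry satisfying `d`. -/
noncomputable def hit (Y : ℕ) (d : α × ℕ → Prop) : List (α × ℕ) → ℝ
  | [] => 0
  | e :: l => if d e then gwt Y e.2 / 8 else hit Y d l / 8

lemma hit_nonneg (d : α × ℕ → Prop) (l : List (α × ℕ)) : 0 ≤ hit Y d l := by
  induction l with
  | nil => exact le_rfl
  | cons e l ih =>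
    have := gwt_pos (Y := Y) e.2
    unfold hit
    split_ifs <;> linarith

lemma hit_le {B : ℝ} (hB : 0 ≤ B) (d : α × ℕ → Prop) {l : List (α × ℕ)}
    (h : ∀ e ∈ l, d e → gwt Y e.2 ≤ B) : hit Y d l ≤ B / 8 := by
  induction l with
  | nil => simp only [hit]; linarith
  | cons e l ih =>
    have := ih fun a ha => h a (List.mem_cons_of_mem _ ha)
    unfold hit
    split_ifs with hd
    · have := h e (List.mem_cons_self ..) hd
      linarith
    · linarith

open Classical in
/-- Dropping everything from the first `d`-entry on and inserting an entry of weight `x`. -/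
lemma pot_takeWhile {x : ℝ} (hx : 0 ≤ x) {d d' : α × ℕ → Prop} (hdd : ∀ e, d' e → d e)
    {l : List (α × ℕ)} (hl : l.Pairwise fun a b => a.2 ≤ b.2)
    (h : ∀ e ∈ l, d e → gwt Y e.2 ≤ x) (h' : ∀ e ∈ l, d' e → 3 / 2 * gwt Y e.2 ≤ x) :
    pot Y l - 2 / 7 * hit Y d l + 4 / 7 * hit Y d' l + 1 / 28 * (1 / 8) ^ (l.length + 1) * x ≤
      pot Y (l.takeWhile fun e => ¬ d e) +
        (1 / 8) ^ ((l.takeWhile fun e => ¬ d e).length + 1) * x := by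
  induction l with
  | nil => simp [pot, hit]; linarith
  | cons e l ih =>
    have hl' := List.pairwise_cons.1 hl
    have ih := ih hl'.2 (fun a ha => h a (List.mem_cons_of_mem _ ha))
      (fun a ha => h' a (List.mem_cons_of_mem _ ha))
    by_cases hd : d e
    · have hg := gwt_pos (Y := Y) e.2
      have h1 : pot Y (e :: l) ≤ gwt Y e.2 / 7 := by
        refine pot_le_seventh hg.le fun a ha => ?_
        rcases List.mem_cons.1 ha with rfl | ha
        · exact le_rfl
        · exact gwt_anti (hl'.1 a ha)
      have h2 : hit Y d' l ≤ gwt Y e.2 / 8 :=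
        hit_le hg.le _ fun a ha _ => gwt_anti (hl'.1 a ha)
      have h3 := h e (List.mem_cons_self ..) hd
      have h4 : (1 / 8 : ℝ) ^ ((e :: l).length + 1) * x ≤ 1 / 64 * x := by
        refine mul_le_mul_of_nonneg_right ?_ hx
        calc (1 / 8 : ℝ) ^ ((e :: l).length + 1) ≤ (1 / 8) ^ 2 :=
              pow_le_pow_of_le_one (by norm_num) (by norm_num) (by simp)
          _ = 1 / 64 := by norm_num
      have e1 : (e :: l).takeWhile (fun e => ¬ d e) = [] := by simp [hd]
      have e2 : hit Y d (e :: l) = gwt Y e.2 / 8 := by simp [hit, hd]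
      rw [e1, e2]
      simp only [pot, List.length_nil, zero_add, pow_one] at h1 ⊢
      by_cases hd' : d' e
      · have h5 := h' e (List.mem_cons_self ..) hd'
        have e3 : hit Y d' (e :: l) = gwt Y e.2 / 8 := by simp [hit, hd']
        rw [e3]
        linarith
      · have e3 : hit Y d' (e :: l) = hit Y d' l / 8 := by simp [hit, hd']
        rw [e3]
        linarith
    · have hd' : ¬ d' e := fun h => hd (hdd e h)
      have e1 : (e :: l).takeWhile (fun e => ¬ d e) = e :: l.takeWhile fun e => ¬ d e := by
        simp [hd]
      rw [e1]
      simp only [hit, hd, hd', if_false, pot, List.length_cons]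
      rw [pow_succ _ (l.length + 1), pow_succ _ (_ + 1)]
      linarith

end MinorFree

namespace MinorFree

/-- A distribution on `{0, …, N Y - 1}` with half-life `Y` (a truncated exponential). -/
structure IsTexp (N Y : ℕ) (p : ℕ → ℝ) : Prop where
  nonneg : ∀ R, 0 ≤ p R
  sum_eq : ∑ R ∈ Finset.range (N * Y), p R = 1
  half : ∀ R, p R = 2 * p (R + Y)
  hazard : ∀ R < N * Y,
    p R ≤ 2 / Y * (∑ R' ∈ Finset.Ico R (N * Y), p R' + (1 / 2) ^ N)
  last : ∑ R ∈ Finset.Ico ((N - 1) * Y) (N * Y), p R ≤ 2 * (1 / 2) ^ N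

lemma exists_isTexp {N Y : ℕ} (hN : 0 < N) (hY : 0 < Y) : ∃ p, IsTexp N Y p := by
  have hY' : (0 : ℝ) < Y := by exact_mod_cast hY
  set θ : ℝ := (1 / 2 : ℝ) ^ (1 / Y : ℝ) with hθ
  have hθ0 : 0 < θ := by positivity
  have hθY : θ ^ Y = 1 / 2 := by
    rw [hθ, ← Real.rpow_natCast, ← Real.rpow_mul (by norm_num), one_div_mul_cancel hY'.ne',
      Real.rpow_one]
  have hθ1 : θ ≤ 1 := Real.rpow_le_one (by norm_num) (by norm_num) (by positivity)
  have hθ2 : 1 - θ ≤ 1 / Y := by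
    by_contra hcon
    push Not at hcon
    have h1 : θ < 1 - 1 / Y := by linarith
    have h2 : (1 / 2 : ℝ) < (1 - 1 / Y) ^ Y := hθY ▸ pow_lt_pow_left₀ h1 hθ0.le hY.ne'
    have h3 : (1 : ℝ) + Y * (1 / Y) ≤ (1 + 1 / Y) ^ Y :=
      one_add_mul_le_pow (by have : (0 : ℝ) < 1 / Y := by positivity
                             linarith) Y
    rw [mul_one_div_cancel hY'.ne'] at h3
    have h4 : ((1 : ℝ) - 1 / Y) ^ Y * (1 + 1 / Y) ^ Y ≤ 1 := by
      rw [← mul_pow]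
      refine pow_le_one₀ ?_ ?_
      · exact mul_nonneg (by linarith) (by positivity)
      · have : (0 : ℝ) ≤ (1 / Y) ^ 2 := by positivity
        nlinarith
    nlinarith
  have hpart : ∀ a b : ℕ, a ≤ b → ∑ R ∈ Finset.Ico a b, θ ^ R * (1 - θ) = θ ^ a - θ ^ b := by
    intro a b hab
    induction b, hab using Nat.le_induction with
    | base => simp
    | succ b hab ih => rw [Finset.sum_Ico_succ_top hab, ih, pow_succ]; ring
  have hNY : θ ^ (N * Y) = (1 / 2) ^ N := by rw [mul_comm, pow_mul, hθY]
  set c : ℝ := 1 - (1 / 2) ^ N with hc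
  have hhalf : ((1 : ℝ) / 2) ^ N ≤ 1 / 2 := by
    simpa using pow_le_pow_of_le_one (a := (1 / 2 : ℝ)) (by norm_num) (by norm_num) hN
  have hpos : (0 : ℝ) < (1 / 2) ^ N := by positivity
  have hc0 : 1 / 2 ≤ c := by rw [hc]; linarith
  have hc1 : 0 < c := by linarith
  have hpart' : ∀ a b : ℕ, a ≤ b →
      ∑ R ∈ Finset.Ico a b, θ ^ R * (1 - θ) / c = (θ ^ a - θ ^ b) / c := by
    intro a b hab
    rw [← Finset.sum_div, hpart a b hab]
  have hcinv : (1 / 2 : ℝ) ^ N / c ≤ 2 * (1 / 2) ^ N := by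
    rw [div_le_iff₀ hc1]
    nlinarith
  refine ⟨fun R => θ ^ R * (1 - θ) / c, ?_, ?_, ?_, ?_, ?_⟩
  · intro R
    exact div_nonneg (mul_nonneg (by positivity) (by linarith)) hc1.le
  · rw [Finset.range_eq_Ico, hpart' _ _ (Nat.zero_le _), pow_zero, hNY, div_self hc1.ne']
  · intro R
    rw [pow_add, hθY]; ring
  · intro R hR
    rw [hpart' _ _ hR.le, hNY]
    have hR0 : 0 < θ ^ R := by positivity
    calc θ ^ R * (1 - θ) / c = (1 - θ) * (θ ^ R / c) := by ring
      _ ≤ 1 / Y * (θ ^ R / c) := mul_le_mul_of_nonneg_right hθ2 (by positivity)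
      _ ≤ 2 / Y * ((θ ^ R - (1 / 2) ^ N) / c + (1 / 2) ^ N) := by
        have h1 : θ ^ R / c = (θ ^ R - (1 / 2) ^ N) / c + (1 / 2) ^ N / c := by
          rw [← add_div, sub_add_cancel]
        have h2 : 0 ≤ (θ ^ R - (1 / 2) ^ N) / c := by
          refine div_nonneg ?_ hc1.le
          rw [← hNY]
          exact sub_nonneg.2 (pow_le_pow_of_le_one hθ0.le hθ1 hR.le)
        have h3 : θ ^ R / c ≤ 2 * ((θ ^ R - (1 / 2) ^ N) / c + (1 / 2) ^ N) := by linarith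
        calc 1 / Y * (θ ^ R / c) ≤ 1 / Y * (2 * ((θ ^ R - (1 / 2) ^ N) / c + (1 / 2) ^ N)) :=
              mul_le_mul_of_nonneg_left h3 (by positivity)
          _ = _ := by ring
  · rw [hpart' _ _ (Nat.mul_le_mul_right _ (Nat.sub_le _ _)), hNY]
    refine le_trans (le_of_eq ?_) hcinv
    congr 1
    rw [mul_comm, pow_mul, hθY]
    obtain ⟨k, rfl⟩ : ∃ k, N = k + 1 := ⟨N - 1, by omega⟩
    simp only [Nat.add_sub_cancel]
    rw [pow_succ]; ring

variable {V : Type} {G : SimpleGraph V} {W : V → V → ℕ} {U T : Set V} {v : V} {r Y : ℕ}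

/-- `l` is a sorted list of distinct supernodes with upper bounds on their distances to `v`. -/
structure Valid (G : SimpleGraph V) (W : V → V → ℕ) (U : Set V) (past : Set (Set V)) (v : V)
    (l : List (Set V × ℕ)) : Prop where
  cert : ∀ e ∈ l, e.1 ∈ past ∧ Cert G W U e.1 v e.2
  sorted : l.Pairwise fun a b => a.2 ≤ b.2
  nodup : (l.map Prod.fst).Nodup

lemma Valid.length_lt {past : Set (Set V)} {l : List (Set V × ℕ)} (hW : ∀ x y, W x y = W y x)
    (hI : Inv G W U past) (hr : ¬ Pad.HasCliqueMinor G r) (hv : v ∈ U)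
    (h : Valid G W U past v l) : l.length + 1 < r := by
  classical
  have := hI.card_lt hW hr hv (l.map Prod.fst).toFinset (by
    intro X hX
    rw [List.mem_toFinset, List.mem_map] at hX
    obtain ⟨e, he, rfl⟩ := hX
    exact ⟨(h.cert e he).1, _, (h.cert e he).2⟩)
  rwa [List.toFinset_card_of_nodup h.nodup, List.length_map] at this

lemma Cert.le {X : Set V} {s s' : ℕ} (h : Cert G W U X v s) (hs : s ≤ s') :
    Cert G W U X v s' := by
  obtain ⟨q, hq, hX⟩ := h
  exact ⟨q, hq.le hs, hX⟩

open Classical in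
lemma Valid.step {past : Set (Set V)} {l : List (Set V × ℕ)} {R s : ℕ}
    (hI : Inv G W U past) (hTU : T ⊆ U) (hT : T.Nonempty)
    (h : Valid G W U past v l) (hR : v ∉ nbhd G W U T R) (hs : v ∈ nbhd G W U T s) :
    Valid G W (U \ nbhd G W U T R) (insert (nbhd G W U T R) past) v
      (ins (nbhd G W U T R, s - R)
        (l.takeWhile fun e => ¬¬ Cert G W (U \ nbhd G W U T R) e.1 v e.2)) := by
  set B := nbhd G W U T R with hB
  set l' := l.takeWhile fun e => ¬¬ Cert G W (U \ B) e.1 v e.2 with hl'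
  have hsub : l'.Sublist l := List.takeWhile_sublist _
  have hBp : B ∉ past := by
    intro hp
    obtain ⟨t, ht⟩ := hT
    exact Set.disjoint_left.1 (hI.disj _ hp) (subset_nbhd hTU ht) (hTU ht)
  refine ⟨?_, ins_sorted (h.sorted.sublist hsub), ?_⟩
  · intro e he
    rcases List.mem_cons.1 ((ins_perm _ _).mem_iff.1 he) with rfl | he
    · obtain ⟨t, ht, m, hm, hw⟩ := hs
      exact ⟨Set.mem_insert _ _, (hw.cert_nbhd ht hR).le (by omega)⟩
    · have h1 := List.mem_takeWhile_imp he
      exact ⟨Set.mem_insert_of_mem _ (h.cert e (hsub.subset he)).1, by simpa using h1⟩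
  · rw [((ins_perm _ _).map _).nodup_iff, List.map_cons, List.nodup_cons]
    refine ⟨?_, h.nodup.sublist (hsub.map _)⟩
    intro hmem
    obtain ⟨e, he, he'⟩ := List.mem_map.1 hmem
    have h0 := (h.cert e (hsub.subset he)).1
    rw [he'] at h0
    exact hBp h0

lemma small_tail : (1 / 14 : ℝ) * ((3 / 4) ^ (16 * r)) ≤ 1 / 56 * (1 / 8) ^ r ∨ r = 0 := by
  rcases Nat.eq_zero_or_pos r with h | h
  · exact .inr h
  left
  have h1 : ((3 / 4 : ℝ) ^ (16 * r)) ≤ (1 / 32) ^ r := by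
    rw [pow_mul]
    exact pow_le_pow_left₀ (by positivity) (by norm_num) _
  have h2 : ((1 : ℝ) / 32) ^ r = (1 / 4) ^ r * (1 / 8) ^ r := by
    rw [← mul_pow]; norm_num
  have h3 : ((1 : ℝ) / 4) ^ r ≤ 1 / 4 := by
    simpa using pow_le_pow_of_le_one (a := (1 / 4 : ℝ)) (by norm_num) (by norm_num) h
  have h4 : (0 : ℝ) < (1 / 8) ^ r := by positivity
  nlinarith

open Classical in
/-- One carving step raises the expected potential of every remaining vertex, and does so
substantially if the vertex may be captured. -/
lemma vertex_step {past : Set (Set V)} {l : List (Set V × ℕ)} {p : ℕ → ℝ}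
    (hW : ∀ x y, W x y = W y x) (hY : 0 < Y) (hp : IsTexp (16 * r) Y p)
    (hI : Inv G W U past) (hr : ¬ Pad.HasCliqueMinor G r) (hv : v ∈ U) (hTU : T ⊆ U)
    (hT : T.Nonempty) (hl : Valid G W U past v l) :
    ∃ pt : ℕ → ℝ, (∀ R, pt R ≤ 1 / 2) ∧
      (∀ R, v ∉ nbhd G W U T R → ∃ l', Valid G W (U \ nbhd G W U T R)
        (insert (nbhd G W U T R) past) v l' ∧ pt R ≤ pot Y l') ∧
      pot Y l ≤ ∑ R ∈ Finset.range (16 * r * Y), p R * pt R ∧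
      ((∃ R < 16 * r * Y, v ∈ nbhd G W U T R) →
        pot Y l + 1 / 56 * (1 / 8) ^ r * (2 / 3) ^ (16 * r) ≤
          ∑ R ∈ Finset.range (16 * r * Y), p R * pt R) := by
  have hpot : ∀ l : List (Set V × ℕ), pot Y l ≤ 1 / 7 := fun l =>
    pot_le_seventh zero_le_one fun e _ => gwt_le_one _
  by_cases hex : ∃ R, v ∈ nbhd G W U T R
  swap
  · push Not at hex
    refine ⟨fun _ => pot Y l, fun R => by linarith [hpot l], ?_, ?_, ?_⟩
    · intro R _
      refine ⟨l, ⟨fun e he => ⟨Set.mem_insert_of_mem _ (hl.cert e he).1, ?_⟩, hl.sorted,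
        hl.nodup⟩, le_rfl⟩
      by_contra hcon
      exact hex _ ((hl.cert e he).2.of_not hcon)
    · rw [← Finset.sum_mul, hp.sum_eq, one_mul]
    · rintro ⟨R, _, h⟩
      exact absurd h (hex R)
  set s₀ := Nat.find hex with hs₀
  have hmem : v ∈ nbhd G W U T s₀ := Nat.find_spec hex
  have hiff : ∀ R, v ∈ nbhd G W U T R → s₀ ≤ R := fun R h => Nat.find_min' hex h
  set des : ℕ → Set V × ℕ → Prop := fun R e => ¬ Cert G W (U \ nbhd G W U T R) e.1 v e.2
    with hdes
  set nl : ℕ → List (Set V × ℕ) := fun R =>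
    ins (nbhd G W U T R, s₀ - R) (l.takeWhile fun e => ¬ des R e) with hnl
  set pt : ℕ → ℝ := fun R => if v ∈ nbhd G W U T R then 1 / 2 else pot Y (nl R) with hpt
  set H : ℕ → ℝ := fun R => hit Y (des R) l with hH
  set H' : ℕ → ℝ := fun R => hit Y (fun e => Y ≤ R ∧ des (R - Y) e) l with hH'
  set g₀ : ℝ := gwt Y s₀ with hg₀
  have hg₀p : 0 < g₀ := gwt_pos _
  have hlen := hl.length_lt hW hI hr hv
  have hdes_le : ∀ R, ∀ e ∈ l, des R e → s₀ ≤ e.2 + R := fun R e he hd =>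
    hiff _ ((hl.cert e he).2.of_not hd)
  have hdes_mono : ∀ R R', R ≤ R' → ∀ e, des R e → des R' e := fun R R' hRR e hd hc =>
    hd (hc.mono (Set.sdiff_subset_sdiff_right (nbhd_mono hRR)))
  have h8 : ((1 : ℝ) / 8) ^ r ≤ (1 / 8) ^ (l.length + 1) :=
    pow_le_pow_of_le_one (by norm_num) (by norm_num) hlen.le
  have hmain : ∀ R, pot Y l - 2 / 7 * H R + 4 / 7 * H' R + 1 / 28 * (1 / 8) ^ r * g₀ ≤ pt R := by
    intro R
    by_cases hR : v ∈ nbhd G W U T R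
    · have e1 : pt R = 1 / 2 := by simp [hpt, hR]
      have h1 : H' R ≤ 1 / 8 := hit_le zero_le_one _ fun e _ _ => gwt_le_one _
      have h2 : 0 ≤ H R := hit_nonneg _ _
      have h3 : ((1 : ℝ) / 8) ^ r * g₀ ≤ 1 := mul_le_one₀
        (pow_le_one₀ (by norm_num) (by norm_num)) hg₀p.le (gwt_le_one _)
      have := hpot l
      rw [e1]
      linarith
    · have e1 : pt R = pot Y (nl R) := by simp [hpt, hR]
      have hx : g₀ ≤ gwt Y (s₀ - R) := gwt_anti (Nat.sub_le _ _)
      have hRs : R < s₀ := by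
        by_contra hcon
        exact hR (nbhd_mono (by omega) hmem)
      have key := pot_takeWhile (Y := Y) (x := gwt Y (s₀ - R)) (gwt_pos _).le (d := des R)
        (d' := fun e => Y ≤ R ∧ des (R - Y) e)
        (fun e he => hdes_mono _ _ (Nat.sub_le _ _) e he.2) hl.sorted
        (fun e he hd => gwt_anti (by have := hdes_le R e he hd; omega))
        (fun e he hd => by
          have h1 := hdes_le _ e he hd.2
          have h2 : gwt Y e.2 ≤ gwt Y (s₀ - R + 1 * Y) := gwt_anti (by have := hd.1; omega)
          rw [gwt_add hY, pow_one] at h2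
          linarith)
      have h4 := pot_ins (Y := Y) (nbhd G W U T R, s₀ - R)
        (l := l.takeWhile fun e => ¬ des R e) (hl.sorted.sublist (List.takeWhile_sublist _))
      have h5 : (1 / 8 : ℝ) ^ r * g₀ ≤ (1 / 8) ^ (l.length + 1) * gwt Y (s₀ - R) :=
        mul_le_mul h8 hx hg₀p.le (by positivity)
      rw [e1]
      show pot Y l - 2 / 7 * hit Y (des R) l + 4 / 7 * hit Y (fun e => Y ≤ R ∧ des (R - Y) e) l
        + 1 / 28 * (1 / 8) ^ r * g₀ ≤
        pot Y (ins (nbhd G W U T R, s₀ - R) (l.takeWhile fun e => ¬ des R e))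
      refine le_trans ?_ (le_trans key ?_)
      · linarith
      · refine Eq.trans_le ?_ (h4.trans_eq ?_) <;> congr!
  have hsumpt : pot Y l + 1 / 56 * (1 / 8) ^ r * g₀ ≤
      ∑ R ∈ Finset.range (16 * r * Y), p R * pt R := by
    have hr0 : 0 < r := by omega
    have hsplit : 16 * r * Y = Y + (16 * r - 1) * Y := by
      obtain ⟨k, hk⟩ : ∃ k, 16 * r = k + 1 := ⟨16 * r - 1, by omega⟩
      rw [hk, Nat.add_sub_cancel]; ring
    have hle : (16 * r - 1) * Y ≤ 16 * r * Y := Nat.mul_le_mul_right _ (Nat.sub_le _ _)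
    have hA : ∑ R ∈ Finset.range (16 * r * Y), p R * H' R ≥
        1 / 2 * ∑ R ∈ Finset.range ((16 * r - 1) * Y), p R * H R := by
      rw [hsplit, Finset.sum_range_add]
      have h1 : 0 ≤ ∑ R ∈ Finset.range Y, p R * H' R :=
        Finset.sum_nonneg fun R _ => mul_nonneg (hp.nonneg R) (hit_nonneg _ _)
      have h2 : ∑ R ∈ Finset.range ((16 * r - 1) * Y), p (Y + R) * H' (Y + R) =
          1 / 2 * ∑ R ∈ Finset.range ((16 * r - 1) * Y), p R * H R := by
        rw [Finset.mul_sum]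
        refine Finset.sum_congr rfl fun R _ => ?_
        have : H' (Y + R) = H R := by simp [hH', hH]
        rw [this, hp.half R, add_comm Y R]; ring
      linarith
    have hB : ∑ R ∈ Finset.range (16 * r * Y), p R * H R =
        ∑ R ∈ Finset.range ((16 * r - 1) * Y), p R * H R +
        ∑ R ∈ Finset.Ico ((16 * r - 1) * Y) (16 * r * Y), p R * H R :=
      (Finset.sum_range_add_sum_Ico _ hle).symm
    have hC : ∑ R ∈ Finset.Ico ((16 * r - 1) * Y) (16 * r * Y), p R * H R ≤
        2 * (1 / 2) ^ (16 * r) * ((3 / 2) ^ (16 * r) * g₀ / 8) := by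
      calc ∑ R ∈ Finset.Ico ((16 * r - 1) * Y) (16 * r * Y), p R * H R
          ≤ ∑ R ∈ Finset.Ico ((16 * r - 1) * Y) (16 * r * Y),
              p R * ((3 / 2) ^ (16 * r) * g₀ / 8) := by
            refine Finset.sum_le_sum fun R hR => mul_le_mul_of_nonneg_left ?_ (hp.nonneg R)
            refine hit_le (by positivity) _ fun e he hd => ?_
            have h1 := hdes_le R e he hd
            have h2 : gwt Y (e.2 + 16 * r * Y) ≤ g₀ :=
              gwt_anti (by have := (Finset.mem_Ico.1 hR).2; omega)
            rw [gwt_add hY] at h2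
            calc gwt Y e.2 = (3 / 2) ^ (16 * r) * ((2 / 3) ^ (16 * r) * gwt Y e.2) := by
                  rw [← mul_assoc, ← mul_pow]; norm_num
              _ ≤ _ := mul_le_mul_of_nonneg_left h2 (by positivity)
        _ = (∑ R ∈ Finset.Ico ((16 * r - 1) * Y) (16 * r * Y), p R) *
              ((3 / 2) ^ (16 * r) * g₀ / 8) := by rw [Finset.sum_mul]
        _ ≤ _ := mul_le_mul_of_nonneg_right hp.last (by positivity)
    have hD : 2 * (1 / 2) ^ (16 * r) * ((3 / 2) ^ (16 * r) * g₀ / 8) =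
        1 / 4 * ((3 / 4) ^ (16 * r)) * g₀ := by
      have : ((3 : ℝ) / 4) ^ (16 * r) = (1 / 2) ^ (16 * r) * (3 / 2) ^ (16 * r) := by
        rw [← mul_pow]; norm_num
      rw [this]; ring
    have hE : (1 / 14 : ℝ) * ((3 / 4) ^ (16 * r)) ≤ 1 / 56 * (1 / 8) ^ r :=
      small_tail.resolve_right (by omega)
    have hF : ∑ R ∈ Finset.range (16 * r * Y), p R * pt R ≥
        ∑ R ∈ Finset.range (16 * r * Y), p R *
          (pot Y l - 2 / 7 * H R + 4 / 7 * H' R + 1 / 28 * (1 / 8) ^ r * g₀) :=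
      Finset.sum_le_sum fun R _ => mul_le_mul_of_nonneg_left (hmain R) (hp.nonneg R)
    have hG : ∑ R ∈ Finset.range (16 * r * Y), p R *
          (pot Y l - 2 / 7 * H R + 4 / 7 * H' R + 1 / 28 * (1 / 8) ^ r * g₀) =
        (∑ R ∈ Finset.range (16 * r * Y), p R) * (pot Y l + 1 / 28 * (1 / 8) ^ r * g₀) -
          2 / 7 * ∑ R ∈ Finset.range (16 * r * Y), p R * H R +
          4 / 7 * ∑ R ∈ Finset.range (16 * r * Y), p R * H' R := by
      rw [Finset.sum_mul, Finset.mul_sum, Finset.mul_sum, ← Finset.sum_sub_distrib,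
        ← Finset.sum_add_distrib]
      exact Finset.sum_congr rfl fun R _ => by ring
    rw [hG, hp.sum_eq, hB] at hF
    have hE' := mul_le_mul_of_nonneg_right hE hg₀p.le
    rw [hD] at hC
    linarith
  refine ⟨pt, ?_, ?_, ?_, ?_⟩
  · intro R
    show (if v ∈ nbhd G W U T R then (1 / 2 : ℝ) else pot Y (nl R)) ≤ 1 / 2
    split_ifs
    · exact le_rfl
    · linarith [hpot (nl R)]
  · intro R hR
    exact ⟨nl R, hl.step hI hTU hT hR hmem, by simp [hpt, hR]⟩
  · have : 0 < 1 / 56 * (1 / 8) ^ r * g₀ := by positivity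
    linarith
  · rintro ⟨R, hR, hvR⟩
    have h1 : gwt Y (0 + 16 * r * Y) ≤ g₀ := gwt_anti (by have := hiff R hvR; omega)
    rw [gwt_add hY] at h1
    have h2 : gwt Y 0 = 1 := by simp [gwt]
    rw [h2, mul_one] at h1
    have := mul_le_mul_of_nonneg_left h1 (show (0 : ℝ) ≤ 1 / 56 * (1 / 8) ^ r by positivity)
    linarith

end MinorFree

namespace MinorFree

variable {V : Type} {G : SimpleGraph V} {W : V → V → ℕ} {X : Set V} {S : ℕ}

lemma dst_triangle {u v t : V} (hX : Conn G W X) (hu : u ∈ X) (hv : v ∈ X) (ht : t ∈ X) (h : G.Adj u v) :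
    dst G W X u t ≤ W u v + dst G W X v t := by
  obtain ⟨n, hn⟩ := hX.2 v hv t ht
  exact dst_le (Wk.cons hu h hn.dst).wn

open Classical in
/-- A set of functions that meets every line in direction `t` in at most `k` points. -/
lemma card_mul_le_of_lines [Fintype V] (A : Finset (V → Fin S)) (t : V) (k : ℕ)
    (h : ∀ σ : V → Fin S, (Finset.univ.filter fun s => Function.update σ t s ∈ A).card ≤ k) :
    A.card * S ≤ Fintype.card (V → Fin S) * k := by
  have h1 : (A ×ˢ (Finset.univ : Finset (Fin S))).card ≤
      ((Finset.univ : Finset (V → Fin S)).sigma fun σ =>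
        Finset.univ.filter fun s => Function.update σ t s ∈ A).card := by
    refine Finset.card_le_card_of_injOn
      (fun x => ⟨Function.update x.1 t x.2, x.1 t⟩) ?_ ?_
    · rintro ⟨τ, c⟩ hx
      have : τ ∈ A := (Finset.mem_product.1 hx).1
      simpa using this
    · rintro ⟨τ, c⟩ _ ⟨τ', c'⟩ _ he
      simp only [Sigma.mk.injEq, heq_eq_eq] at he
      obtain ⟨h1, h2⟩ := he
      have hc : c = c' := by simpa using congrFun h1 t
      have : τ = τ' := by
        funext x
        by_cases hx : x = t
        · rw [hx, h2]
        · simpa [hx] using congrFun h1 x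
      rw [this, hc]
  rw [Finset.card_product, Finset.card_univ, Fintype.card_fin, Finset.card_sigma] at h1
  refine h1.trans ((Finset.sum_le_sum fun σ _ => h σ).trans ?_)
  simp

/-- Shifted distance from `u` to the centre `t`, with ties broken by an enumeration of `V`. -/
noncomputable def skey [Fintype V] (G : SimpleGraph V) (W : V → V → ℕ) (X : Set V)
    (σ : V → Fin S) (u t : V) : ℕ :=
  (σ t + dst G W X u t) * Fintype.card V + Fintype.equivFin V t

/-- The centre `t` minimises the shifted distance from `u`. -/
def IsWin [Fintype V] (G : SimpleGraph V) (W : V → V → ℕ) (X : Set V) (Z : Finset V)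
    (σ : V → Fin S) (u t : V) : Prop :=
  t ∈ Z ∧ ∀ t' ∈ Z, skey G W X σ u t ≤ skey G W X σ u t'

variable [Fintype V] {Z : Finset V} {σ : V → Fin S} {u v t t' : V}

lemma le_of_skey_le (h : skey G W X σ u t ≤ skey G W X σ v t') :
    σ t + dst G W X u t ≤ σ t' + dst G W X v t' := by
  by_contra hcon
  push Not at hcon
  unfold skey at h
  have h1 : (σ t' + dst G W X v t' + 1) * Fintype.card V ≤
      (σ t + dst G W X u t) * Fintype.card V := Nat.mul_le_mul_right _ hcon
  rw [add_mul, one_mul] at h1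
  have := (Fintype.equivFin V t').isLt
  omega

lemma IsWin.eq (h : IsWin G W X Z σ u t) (h' : IsWin G W X Z σ u t') : t = t' := by
  have h0 : skey G W X σ u t = skey G W X σ u t' := le_antisymm (h.2 _ h'.1) (h'.2 _ h.1)
  have h1 := le_of_skey_le h0.le
  have h2 := le_of_skey_le h0.ge
  unfold skey at h0
  rw [le_antisymm h1 h2] at h0
  exact (Fintype.equivFin V).injective (Fin.ext (by omega))

lemma exists_isWin (hZ : Z.Nonempty) (σ : V → Fin S) (u : V) : ∃ t, IsWin G W X Z σ u t := by
  obtain ⟨t, ht, h⟩ := Z.exists_min_image (skey G W X σ u) hZ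
  exact ⟨t, ht, h⟩

/-- A winning centre keeps winning along shortest walks towards it. -/
lemma IsWin.of_adj (hX : Conn G W X) (hZ : ∀ z ∈ Z, z ∈ X) (hu : u ∈ X) (hv : v ∈ X)
    (h : G.Adj u v) (hw : IsWin G W X Z σ u t)
    (hd : dst G W X u t = W u v + dst G W X v t) : IsWin G W X Z σ v t := by
  refine ⟨hw.1, fun t' ht' => ?_⟩
  have h1 := hw.2 t' ht'
  have h2 := dst_triangle hX hu hv (hZ _ ht') h
  unfold skey at h1 ⊢
  have h3 := Nat.mul_le_mul_right (Fintype.card V) (Nat.add_le_add_left h2 (σ t'))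
  rw [hd] at h1
  simp only [add_mul] at h1 h3 ⊢
  omega

lemma Wk.to_winner (hX : Conn G W X) (hZ : ∀ z ∈ Z, z ∈ X) {n : ℕ} (h : Wk G W X u t n)
    (hn : n = MinorFree.dst G W X u t) (hw : IsWin G W X Z σ u t) :
    Wk G W {x ∈ X | IsWin G W X Z σ x t} u t n := by
  induction h with
  | nil h => exact .nil ⟨h, hw⟩
  | @cons x y z n h1 h2 h3 ih =>
    have hd := dst_triangle hX h1 h3.left_mem h3.right_mem h2
    have hd' := dst_le h3.wn
    exact .cons ⟨h1, hw⟩ h2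
      (ih (by omega) (hw.of_adj hX hZ h1 h3.left_mem h2 (by omega)))

lemma IsWin.dst_lt (hw : IsWin G W X Z σ u t)
    (hnear : ∃ t' ∈ Z, dst G W X u t' < 2 * S) : dst G W X u t < 3 * S := by
  obtain ⟨t', ht', hd⟩ := hnear
  have h1 := le_of_skey_le (hw.2 t' ht')
  have := (σ t').isLt
  omega

open Classical in
/-- Along a line in direction `t`, the centre `t` wins at `u` but not at the neighbour `v` only
on a short range of shifts. -/
lemma card_win_lose (hW : ∀ x y, W x y = W y x) (hX : Conn G W X) (hZ : ∀ z ∈ Z, z ∈ X)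
    (hu : u ∈ X) (hv : v ∈ X) (h : G.Adj u v) (σ : V → Fin S) (t : V) :
    (Finset.univ.filter fun s => IsWin G W X Z (Function.update σ t s) u t ∧
      ¬ IsWin G W X Z (Function.update σ t s) v t).card ≤ 2 * W u v + 1 := by
  set A := Finset.univ.filter fun s => IsWin G W X Z (Function.update σ t s) u t ∧
      ¬ IsWin G W X Z (Function.update σ t s) v t with hA
  rcases A.eq_empty_or_nonempty with h0 | h0
  · rw [h0]; simp
  set a := A.min' h0 with ha
  have ham : a ∈ A := A.min'_mem h0
  have hsub : A.image Fin.val ⊆ Finset.Icc (a : ℕ) (a + 2 * W u v) := by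
    intro i hi
    obtain ⟨s, hs, rfl⟩ := Finset.mem_image.1 hi
    have has : a ≤ s := A.min'_le _ hs
    refine Finset.mem_Icc.2 ⟨has, ?_⟩
    have hs1 := (Finset.mem_filter.1 hs).2.1
    obtain ⟨ha1, ha2⟩ := (Finset.mem_filter.1 ham).2
    have htZ : t ∈ Z := hs1.1
    obtain ⟨t', ht', hlt⟩ : ∃ t' ∈ Z, skey G W X (Function.update σ t a) v t' <
        skey G W X (Function.update σ t a) v t := by
      by_contra hcon
      push Not at hcon
      exact ha2 ⟨htZ, hcon⟩
    have hne : t' ≠ t := by rintro rfl; exact lt_irrefl _ hlt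
    have h1 := le_of_skey_le hlt.le
    have h2 := le_of_skey_le (hs1.2 t' ht')
    simp only [Function.update_self, Function.update_of_ne hne] at h1 h2
    have h3 := dst_triangle hX hu hv (hZ _ ht') h
    have h4 := dst_triangle hX hv hu (hZ _ htZ) h.symm
    rw [hW v u] at h4
    omega
  have := Finset.card_le_card hsub
  rw [Finset.card_image_of_injective _ Fin.val_injective, Nat.card_Icc] at this
  omega

open Classical in
/-- Ball growing with independent uniform shifts from a net of centres. -/
lemma hasDecomp_of_net (hW : ∀ x y, W x y = W y x) (hX : Conn G W X) (hS : 0 < S) {k : ℕ}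
    (hZ : ∀ z ∈ Z, z ∈ X) (hnear : ∀ u ∈ X, ∃ t ∈ Z, dst G W X u t < 2 * S)
    (hpack : ∀ u ∈ X, (Z.filter fun t => dst G W X u t < 3 * S).card ≤ k) :
    HasDecomp G W X (6 * S) fun u v => k * (3 * W u v) / S := by
  have hZne : Z.Nonempty := by
    obtain ⟨x, hx⟩ := hX.1
    obtain ⟨t, ht, _⟩ := hnear x hx
    exact ⟨t, ht⟩
  have : NeZero S := ⟨hS.ne'⟩
  have hcard : 0 < Fintype.card (V → Fin S) := Fintype.card_pos
  refine ⟨V → Fin S, inferInstance, fun _ => 1 / Fintype.card (V → Fin S),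
    fun σ u => {x ∈ X | ∀ t, IsWin G W X Z σ x t ↔ IsWin G W X Z σ u t}, ?_, ?_, ?_, ?_⟩
  · intro _; positivity
  · rw [Finset.sum_const, Finset.card_univ, nsmul_eq_mul, mul_one_div_cancel]
    exact_mod_cast hcard.ne'
  · intro σ v hv
    refine ⟨⟨hv, fun _ => Iff.rfl⟩, fun x hx => hx.1, fun u hu => ?_, ?_⟩
    · ext x
      exact and_congr_right fun _ => forall_congr' fun t => by rw [hu.2 t]
    · obtain ⟨t, ht⟩ := exists_isWin (G := G) (W := W) (X := X) hZne σ v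
      have heq : {x ∈ X | ∀ t, IsWin G W X Z σ x t ↔ IsWin G W X Z σ v t} =
          {x ∈ X | IsWin G W X Z σ x t} := by
        ext x
        refine and_congr_right fun _ => ⟨fun h => (h t).2 ht, fun h t' => ⟨fun h' => ?_,
          fun h' => ?_⟩⟩
        · rwa [← h.eq h']
        · rwa [← ht.eq h']
      have key : ∀ x ∈ {x ∈ X | IsWin G W X Z σ x t},
          Wn G W {x ∈ X | IsWin G W X Z σ x t} x t (3 * S) := by
        rintro x ⟨hx, hxt⟩
        obtain ⟨n, hn⟩ := hX.2 x hx t (hZ t hxt.1)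
        exact (hn.dst.to_winner hX hZ rfl hxt).wn.le (hxt.dst_lt (hnear x hx)).le
      intro x hx y hy
      simp only [heq] at hx hy ⊢
      exact ((key x hx).trans ((key y hy).symm hW)).le (by omega)
  · intro u hu v hv huv
    set C := Finset.univ.filter fun σ : V → Fin S =>
      {x ∈ X | ∀ t, IsWin G W X Z σ x t ↔ IsWin G W X Z σ u t} ≠
      {x ∈ X | ∀ t, IsWin G W X Z σ x t ↔ IsWin G W X Z σ v t} with hC
    set E : V → Finset (V → Fin S) := fun t => Finset.univ.filter fun σ =>
      IsWin G W X Z σ u t ∧ ¬ IsWin G W X Z σ v t with hE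
    have hCE : C ⊆ (Z.filter fun t => dst G W X u t < 3 * S).biUnion E := by
      intro σ hσ
      have hσ' := (Finset.mem_filter.1 hσ).2
      obtain ⟨t, ht⟩ := exists_isWin (G := G) (W := W) (X := X) hZne σ u
      refine Finset.mem_biUnion.2 ⟨t, Finset.mem_filter.2 ⟨ht.1, ht.dst_lt (hnear u hu)⟩,
        Finset.mem_filter.2 ⟨Finset.mem_univ _, ht, fun hvt => hσ' ?_⟩⟩
      ext x
      refine and_congr_right fun _ => forall_congr' fun t' => iff_congr Iff.rfl ⟨?_, ?_⟩
      · intro h; rwa [← ht.eq h]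
      · intro h; rwa [← hvt.eq h]
    have hEt : ∀ t, (E t).card * S ≤ Fintype.card (V → Fin S) * (3 * W u v) := by
      intro t
      rcases Nat.eq_zero_or_pos (W u v) with h0 | h0
      · have : E t = ∅ := by
          refine Finset.filter_eq_empty_iff.2 fun σ _ => ?_
          rintro ⟨h1, h2⟩
          refine h2 (h1.of_adj hX hZ hu hv huv ?_)
          have h3 := dst_triangle hX hu hv (hZ _ h1.1) huv
          have h4 := dst_triangle hX hv hu (hZ _ h1.1) huv.symm
          rw [hW v u] at h4
          omega
        rw [this]; simp
      · refine card_mul_le_of_lines _ t _ fun σ => ?_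
        have := card_win_lose hW hX hZ hu hv huv σ t
        simp only [hE, Finset.mem_filter, Finset.mem_univ, true_and]
        omega
    have hCS : C.card * S ≤ k * (Fintype.card (V → Fin S) * (3 * W u v)) := by
      calc C.card * S ≤ (∑ t ∈ Z.filter fun t => dst G W X u t < 3 * S, (E t).card) * S :=
            Nat.mul_le_mul_right _ ((Finset.card_le_card hCE).trans Finset.card_biUnion_le)
        _ = ∑ t ∈ Z.filter fun t => dst G W X u t < 3 * S, (E t).card * S := Finset.sum_mul ..
        _ ≤ ∑ t ∈ Z.filter fun t => dst G W X u t < 3 * S,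
              Fintype.card (V → Fin S) * (3 * W u v) := Finset.sum_le_sum fun t _ => hEt t
        _ ≤ _ := by
            rw [Finset.sum_const, smul_eq_mul]
            exact Nat.mul_le_mul_right _ (hpack u hu)
    have hS' : (0 : ℝ) < S := by exact_mod_cast hS
    have hc' : (0 : ℝ) < Fintype.card (V → Fin S) := by exact_mod_cast hcard
    rw [← Finset.sum_filter, Finset.sum_const, nsmul_eq_mul, mul_one_div,
      div_le_div_iff₀ hc' hS']
    have : (C.card : ℝ) * S ≤ k * (Fintype.card (V → Fin S) * (3 * W u v)) := by
      exact_mod_cast hCS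
    calc _ = (C.card : ℝ) * S := rfl
      _ ≤ _ := this
      _ = _ := by ring

open Classical in
/-- Strong decomposition of a set that is close to a few geodesics. -/
lemma hasDecomp_of_geodesics (hW : ∀ x y, W x y = W y x) (hX : Conn G W X) (hS : 0 < S)
    {φ : V → ℕ} (hφ : ∀ a ∈ X, ∀ b ∈ X, G.Adj a b → φ b ≤ φ a + W a b) (Q : Finset (Set V))
    (hQX : ∀ P ∈ Q, P ⊆ X)
    (hQ : ∀ P ∈ Q, ∀ a ∈ P, ∀ b ∈ P, φ a ≤ φ b → Wn G W P a b (φ b - φ a))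
    (hcov : ∀ x ∈ X, ∃ P ∈ Q, ∃ t ∈ P, Wn G W X x t S) :
    HasDecomp G W X (6 * S) fun u v => (Q.card * 7 : ℕ) * (3 * W u v) / S := by
  obtain ⟨x₀, hx₀⟩ := hX.1
  have hrep : ∀ (P : Set V) (j : ℕ), ∃ z, (∃ x ∈ P, φ x / S = j) → z ∈ P ∧ φ z / S = j := by
    intro P j
    by_cases h : ∃ x ∈ P, φ x / S = j
    · obtain ⟨x, h⟩ := h; exact ⟨x, fun _ => h⟩
    · exact ⟨x₀, fun h' => absurd h' h⟩
  choose rep hrep using hrep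
  set Z : Finset V := Finset.univ.filter fun z => ∃ P ∈ Q, ∃ x ∈ P, z = rep P (φ x / S) with hZ
  have hrep' : ∀ P, ∀ x ∈ P, rep P (φ x / S) ∈ P ∧ φ (rep P (φ x / S)) / S = φ x / S :=
    fun P x hx => hrep P _ ⟨x, hx, rfl⟩
  have hZX : ∀ z ∈ Z, z ∈ X := by
    intro z hz
    obtain ⟨P, hP, x, hx, rfl⟩ := (Finset.mem_filter.1 hz).2
    exact hQX P hP (hrep' P x hx).1
  refine hasDecomp_of_net hW hX hS hZX ?_ ?_
  · intro u hu
    obtain ⟨P, hP, t, ht, hut⟩ := hcov u hu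
    obtain ⟨h1, h2⟩ := hrep' P t ht
    refine ⟨_, Finset.mem_filter.2 ⟨Finset.mem_univ _, P, hP, t, ht, rfl⟩, ?_⟩
    set z := rep P (φ t / S)
    have h3 := Nat.div_add_mod (φ z) S
    have h4 := Nat.div_add_mod (φ t) S
    have h5 := Nat.mod_lt (φ z) hS
    have h6 := Nat.mod_lt (φ t) hS
    rw [h2] at h3
    have hw : Wn G W X t z (S - 1) := by
      rcases le_total (φ t) (φ z) with h | h
      · exact ((hQ P hP t ht z h1 h).mono (hQX P hP)).le (by omega)
      · exact (((hQ P hP z h1 t ht h).symm hW).mono (hQX P hP)).le (by omega)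
    have := dst_le (hut.trans hw)
    omega
  · intro u hu
    have hsub : (Z.filter fun t => dst G W X u t < 3 * S) ⊆
        (Q ×ˢ Finset.Icc (φ u / S - 3) (φ u / S + 3)).image fun x => rep x.1 x.2 := by
      intro z hz
      obtain ⟨hzZ, hd⟩ := Finset.mem_filter.1 hz
      obtain ⟨P, hP, x, hx, rfl⟩ := (Finset.mem_filter.1 hzZ).2
      refine Finset.mem_image.2 ⟨(P, φ x / S), Finset.mem_product.2 ⟨hP, ?_⟩, rfl⟩
      obtain ⟨h1, h2⟩ := hrep' P x hx
      rw [← h2]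
      set z := rep P (φ x / S)
      obtain ⟨n, hn⟩ := hX.2 u hu z (hQX P hP h1)
      have h3 := hn.dst.le_of_lip hφ
      have h4 := (hn.dst.symm hW).le_of_lip hφ
      have h5 : φ z / S ≤ (φ u + 3 * S) / S := Nat.div_le_div_right (by omega)
      have h6 : φ u / S ≤ (φ z + 3 * S) / S := Nat.div_le_div_right (by omega)
      rw [Nat.add_mul_div_right _ _ hS] at h5 h6
      exact Finset.mem_Icc.2 ⟨Nat.sub_le_iff_le_add.2 h6, h5⟩
    refine (Finset.card_le_card hsub).trans (Finset.card_image_le.trans ?_)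
    rw [Finset.card_product, Nat.card_Icc]
    exact Nat.mul_le_mul_left _ (by omega)

end MinorFree

namespace MinorFree

open Classical in
/-- Amortised cost of an edge of weight `w` in one carving step: `A R` and `B R` say that its
endpoints are captured at radius `R`. -/
lemma carve_cost {r Y w : ℕ} {p : ℕ → ℝ} (hY : 0 < Y) (hp : IsTexp (16 * r) Y p)
    {A B : ℕ → Prop} (hA : ∀ m n, m ≤ n → A m → A n) (hB : ∀ m n, m ≤ n → B m → B n)
    (hAB : ∀ n, A n → B (w + n)) (hBA : ∀ n, B n → A (w + n)) {pu pv cost : ℕ → ℝ} {a b ε : ℝ}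
    (hε : (1 / 14 : ℝ) * (1 / 2) ^ (16 * r) ≤ ε)
    (hpu : ∀ R, pu R ≤ 1 / 2) (hpv : ∀ R, pv R ≤ 1 / 2)
    (hua : a ≤ ∑ R ∈ Finset.range (16 * r * Y), p R * pu R)
    (hua' : (∃ R < 16 * r * Y, A R) → a + ε ≤ ∑ R ∈ Finset.range (16 * r * Y), p R * pu R)
    (hvb : b ≤ ∑ R ∈ Finset.range (16 * r * Y), p R * pv R)
    (hvb' : (∃ R < 16 * r * Y, B R) → b + ε ≤ ∑ R ∈ Finset.range (16 * r * Y), p R * pv R)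
    (hboth : ∀ R < 16 * r * Y, A R → B R → cost R ≤ 2 * (w / Y))
    (hone : ∀ R < 16 * r * Y, cost R ≤ 1 ∨ (A R ↔ B R))
    (hnone : ∀ R < 16 * r * Y, ¬ A R → ¬ B R →
      cost R ≤ w / Y * (4 + 28 * (1 - pu R - pv R))) :
    ∑ R ∈ Finset.range (16 * r * Y), p R * cost R ≤ w / Y * (4 + 28 * (1 - a - b)) := by
  set N := 16 * r * Y with hN
  set D : ℝ := w / Y with hD
  have hY' : (0 : ℝ) < Y := by exact_mod_cast hY
  have hD0 : 0 ≤ D := by positivity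
  set one : ℕ → ℝ := fun R => if A R ↔ B R then 0 else 1 with hone'
  set nei : ℕ → ℝ := fun R => if ¬ A R ∧ ¬ B R then 1 else 0 with hnei'
  have hpt : ∀ R ∈ Finset.range N,
      p R * cost R ≤ p R * (one R + D * (2 + 2 * nei R + 28 * (1 - pu R - pv R))) := by
    intro R hR
    refine mul_le_mul_of_nonneg_left ?_ (hp.nonneg R)
    have hR := Finset.mem_range.1 hR
    have h0 : 0 ≤ D * (1 - pu R - pv R) :=
      mul_nonneg hD0 (by linarith [hpu R, hpv R])
    by_cases h1 : A R <;> by_cases h2 : B R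
    · have := hboth R hR h1 h2
      simp only [hone', hnei', h1, h2]; norm_num; linarith
    · have := (hone R hR).resolve_right (by simp [h1, h2])
      simp only [hone', hnei', h1, h2]; norm_num; linarith
    · have := (hone R hR).resolve_right (by simp [h1, h2])
      simp only [hone', hnei', h1, h2]; norm_num; linarith
    · have := hnone R hR h1 h2
      simp only [hone', hnei', h1, h2]; norm_num; linarith
  set SO := ∑ R ∈ Finset.range N, p R * one R with hSO
  set SN := ∑ R ∈ Finset.range N, p R * nei R with hSN
  have hsum : ∑ R ∈ Finset.range N, p R * (one R + D * (2 + 2 * nei R + 28 * (1 - pu R - pv R)))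
      = SO + D * (2 + 2 * SN + 28 * (1 - ∑ R ∈ Finset.range N, p R * pu R -
          ∑ R ∈ Finset.range N, p R * pv R)) := by
    have : ∀ R, p R * (one R + D * (2 + 2 * nei R + 28 * (1 - pu R - pv R))) =
        p R * one R + (30 * D) * p R + 2 * D * (p R * nei R) - 28 * D * (p R * pu R)
          - 28 * D * (p R * pv R) := fun R => by ring
    simp_rw [this, Finset.sum_sub_distrib, Finset.sum_add_distrib, ← Finset.mul_sum]
    rw [hp.sum_eq]; ring
  refine (Finset.sum_le_sum hpt).trans (hsum.trans_le ?_)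
  have hSN1 : SN ≤ 1 := by
    rw [← hp.sum_eq]
    refine Finset.sum_le_sum fun R _ => ?_
    refine (mul_le_mul_of_nonneg_left (?_ : nei R ≤ 1) (hp.nonneg R)).trans_eq (mul_one _)
    simp only [hnei']; split_ifs <;> norm_num
  set O := (Finset.range N).filter fun R => ¬ (A R ↔ B R) with hO
  rcases O.eq_empty_or_nonempty with h0 | h0
  · have : SO = 0 := by
      refine Finset.sum_eq_zero fun R hR => ?_
      have := Finset.filter_eq_empty_iff.1 h0 hR
      rw [not_not] at this
      simp [hone', this]
    rw [this, zero_add]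
    exact mul_le_mul_of_nonneg_left (by linarith) hD0
  · set R₁ := O.min' h0 with hR₁
    have hR₁m := Finset.mem_filter.1 (O.min'_mem h0)
    have hR₁N := Finset.mem_range.1 hR₁m.1
    have hor : A R₁ ∨ B R₁ := by
      by_contra hcon
      push Not at hcon
      exact hR₁m.2 (iff_of_false hcon.1 hcon.2)
    have hsub : O ⊆ Finset.Ico R₁ (R₁ + w) := by
      intro R hR
      refine Finset.mem_Ico.2 ⟨O.min'_le _ hR, ?_⟩
      by_contra hcon
      push Not at hcon
      refine (Finset.mem_filter.1 hR).2 (iff_of_true ?_ ?_)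
      · rcases hor with h | h
        · exact hA _ _ (by omega) h
        · exact hA (w + R₁) _ (by omega) (hBA _ h)
      · rcases hor with h | h
        · exact hB (w + R₁) _ (by omega) (hAB _ h)
        · exact hB _ _ (by omega) h
    have hOc : (O.card : ℝ) ≤ w := by
      have := Finset.card_le_card hsub
      rw [Nat.card_Ico] at this
      exact_mod_cast (by omega : O.card ≤ w)
    have htail : ∀ R, R₁ ≤ R → ∑ R' ∈ Finset.Ico R N, p R' ≤ 1 - SN := by
      intro R hR
      have h1 : 1 - SN = ∑ R ∈ Finset.range N, p R * (1 - nei R) := by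
        simp_rw [mul_sub, mul_one, Finset.sum_sub_distrib]
        rw [hp.sum_eq]
      rw [h1]
      have h2 : ∀ R', 0 ≤ 1 - nei R' := fun R' => by
        simp only [hnei']; split_ifs <;> norm_num
      refine (Finset.sum_le_sum (g := fun R' => p R' * (1 - nei R')) (fun R' hR' => ?_)).trans
        (Finset.sum_le_sum_of_subset_of_nonneg (s := Finset.Ico R N) ?_
          fun R' _ _ => mul_nonneg (hp.nonneg R') (h2 R'))
      · have hR' := (Finset.mem_Ico.1 hR').1
        have : nei R' = 0 := by
          simp only [hnei']
          rw [if_neg]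
          rintro ⟨h1, h2⟩
          rcases hor with h | h
          · exact h1 (hA _ _ (by omega) h)
          · exact h2 (hB _ _ (by omega) h)
        rw [this, sub_zero, mul_one]
      · intro R' hR'
        exact Finset.mem_range.2 (Finset.mem_Ico.1 hR').2
    have hSO1 : SO ≤ w * (2 / Y * (1 - SN + (1 / 2) ^ (16 * r))) := by
      have h1 : SO = ∑ R ∈ O, p R := by
        rw [hSO, hO, Finset.sum_filter]
        refine Finset.sum_congr rfl fun R _ => ?_
        by_cases h : A R ↔ B R <;> simp [hone', h]
      have h2 : ∀ R ∈ O, p R ≤ 2 / Y * (1 - SN + (1 / 2) ^ (16 * r)) := by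
        intro R hR
        refine (hp.hazard R (Finset.mem_range.1 (Finset.mem_filter.1 hR).1)).trans ?_
        refine mul_le_mul_of_nonneg_left ?_ (by positivity)
        linarith [htail R (O.min'_le _ hR)]
      rw [h1]
      refine (Finset.sum_le_sum h2).trans ?_
      rw [Finset.sum_const, nsmul_eq_mul]
      refine mul_le_mul_of_nonneg_right hOc ?_
      have : (0 : ℝ) < (1 / 2) ^ (16 * r) := by positivity
      exact mul_nonneg (by positivity) (by linarith)
    have hgain : a + b + ε ≤ ∑ R ∈ Finset.range N, p R * pu R +
        ∑ R ∈ Finset.range N, p R * pv R := by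
      rcases hor with h | h
      · linarith [hua' ⟨R₁, hR₁N, h⟩]
      · linarith [hvb' ⟨R₁, hR₁N, h⟩]
    have hw : (w : ℝ) * (2 / Y * (1 - SN + (1 / 2) ^ (16 * r))) =
        D * (2 * (1 - SN + (1 / 2) ^ (16 * r))) := by rw [hD]; ring
    rw [hw] at hSO1
    refine (add_le_add_left hSO1 _).trans ?_
    rw [← mul_add]
    exact mul_le_mul_of_nonneg_left (by linarith) hD0

variable {V : Type} {G : SimpleGraph V} {W : V → V → ℕ} {U : Set V} {r Y : ℕ}

lemma dst_lip_of_mem {t₀ a b : V} (ha : a ∈ U) (hb : b ∈ U)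
    (h : G.Adj a b) : dst G W U t₀ b ≤ dst G W U t₀ a + W a b := by
  by_cases hr : ∃ n, Wk G W U t₀ b n
  · obtain ⟨n, hn⟩ := hr
    exact dst_lip ⟨_, hn.trans (.edge hb ha h.symm)⟩ hb h
  · have : {n | Wk G W U t₀ b n} = ∅ :=
      Set.eq_empty_iff_forall_notMem.2 fun n hn => hr ⟨n, hn⟩
    simp [dst, this]

open Classical in
/-- A core: few geodesics from `t₀` reaching every earlier supernode visible from `t₀`. -/
lemma exists_core [Fintype V] (hW : ∀ x y, W x y = W y x) (hr : ¬ Pad.HasCliqueMinor G r)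
    {past : Set (Set V)} (hI : Inv G W U past) {t₀ : V} (ht₀ : t₀ ∈ U) :
    ∃ (T : Set V) (Q : Finset (Set V)), t₀ ∈ T ∧ T ⊆ U ∧ (∀ t ∈ T, ∃ n, Wk G W T t₀ t n) ∧
      (∀ X ∈ past, (∃ s, Cert G W U X t₀ s) → ∃ q ∈ T, Touch G q X) ∧ Q.card ≤ r ∧
      (∀ P ∈ Q, P ⊆ T) ∧ (∀ t ∈ T, ∃ P ∈ Q, t ∈ P) ∧
      ∀ P ∈ Q, ∀ a ∈ P, ∀ b ∈ P, dst G W U t₀ a ≤ dst G W U t₀ b →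
        Wn G W P a b (dst G W U t₀ b - dst G W U t₀ a) := by
  set φ := dst G W U t₀ with hφ
  have hφ0 : φ t₀ = 0 := Nat.le_zero.1 (dst_le (Wk.nil ht₀).wn)
  set K : Finset (Set V) := Finset.univ.filter fun X => X ∈ past ∧ ∃ s, Cert G W U X t₀ s
    with hK
  have hKc : K.card + 1 < r := hI.card_lt hW hr ht₀ K fun X hX => (Finset.mem_filter.1 hX).2
  have hP : ∀ X : Set V, ∃ P, X ∈ K → P ⊆ U ∧ t₀ ∈ P ∧ (∃ q ∈ P, Touch G q X) ∧
      ∀ a ∈ P, ∀ b ∈ P, φ a ≤ φ b → Wn G W P a b (φ b - φ a) := by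
    intro X
    by_cases hX : X ∈ K
    · obtain ⟨-, -, s, q, ⟨m, _, hm⟩, hq⟩ := Finset.mem_filter.1 hX
      obtain ⟨P, h1, h2, h3, -, h5⟩ := hm.dst.exists_geodesic hW (φ := φ)
        (fun a ha b hb h => dst_lip_of_mem ha hb h) (by rw [hφ0, zero_add])
      exact ⟨P, fun _ => ⟨h1, h2, ⟨q, h3, hq⟩, h5⟩⟩
    · exact ⟨∅, fun h => absurd h hX⟩
  choose P hP using hP
  set Q : Finset (Set V) := insert {t₀} (K.image P) with hQ
  have hQall : ∀ P' ∈ Q, P' ⊆ U ∧ t₀ ∈ P' ∧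
      ∀ a ∈ P', ∀ b ∈ P', φ a ≤ φ b → Wn G W P' a b (φ b - φ a) := by
    intro P' hP'
    rcases Finset.mem_insert.1 hP' with rfl | hP'
    · refine ⟨Set.singleton_subset_iff.2 ht₀, rfl, ?_⟩
      rintro a rfl b rfl _
      exact ⟨0, Nat.zero_le _, .nil rfl⟩
    · obtain ⟨X, hX, rfl⟩ := Finset.mem_image.1 hP'
      obtain ⟨h1, h2, -, h4⟩ := hP X hX
      exact ⟨h1, h2, h4⟩
  have hsub : ∀ P' ∈ Q, P' ⊆ {x | ∃ P' ∈ Q, x ∈ P'} := fun P' hP' x hx => ⟨P', hP', hx⟩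
  refine ⟨{x | ∃ P' ∈ Q, x ∈ P'}, Q, ⟨_, Finset.mem_insert_self _ _, rfl⟩, ?_, ?_, ?_, ?_, hsub,
    fun t ht => ht, fun P' hP' => (hQall P' hP').2.2⟩
  · rintro x ⟨P', hP', hx⟩
    exact (hQall P' hP').1 hx
  · rintro t ⟨P', hP', ht⟩
    obtain ⟨-, h2, h3⟩ := hQall P' hP'
    obtain ⟨m, -, hm⟩ := h3 t₀ h2 t ht (by rw [hφ0]; exact Nat.zero_le _)
    exact ⟨m, hm.mono (hsub P' hP')⟩
  · intro X hX hc
    have hXK : X ∈ K := Finset.mem_filter.2 ⟨Finset.mem_univ _, hX, hc⟩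
    obtain ⟨-, -, ⟨q, hq, hqX⟩, -⟩ := hP X hXK
    exact ⟨q, ⟨P X, Finset.mem_insert_of_mem (Finset.mem_image_of_mem _ hXK), hq⟩, hqX⟩
  · have h1 : Q.card ≤ (K.image P).card + 1 := Finset.card_insert_le _ _
    have h2 : (K.image P).card ≤ K.card := Finset.card_image_le
    omega

/-- The recursive carving: the cost of an edge is controlled by the potentials of its
endpoints. -/
lemma exists_hasDecomp [Fintype V] (hW : ∀ x y, W x y = W y x)
    (hr : ¬ Pad.HasCliqueMinor G r) (hr0 : 0 < r) (hY : 0 < Y) {p : ℕ → ℝ}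
    (hp : IsTexp (16 * r) Y p) (n : ℕ) : ∀ (U : Set V) (past : Set (Set V)), U.ncard ≤ n →
    Inv G W U past → ∃ b, HasDecomp G W U (6 * (16 * r * Y)) b ∧
      ∀ u ∈ U, ∀ v ∈ U, G.Adj u v → ∀ lu lv, Valid G W U past u lu → Valid G W U past v lv →
        b u v ≤ W u v / Y * (4 + 28 * (1 - pot Y lu - pot Y lv)) := by
  classical
  induction n with
  | zero =>
    intro U past hU _
    have hU0 : U = ∅ := (Set.ncard_eq_zero (Set.toFinite U)).1 (Nat.le_zero.1 hU)
    subst hU0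
    refine ⟨fun _ _ => 0, ⟨Unit, inferInstance, fun _ => 1, fun _ _ => ∅, ?_, ?_, ?_, ?_⟩, ?_⟩
    · intro _; exact zero_le_one
    · simp
    · intro _ v hv; exact absurd hv (Set.notMem_empty v)
    · intro u hu; exact absurd hu (Set.notMem_empty u)
    · intro u hu; exact absurd hu (Set.notMem_empty u)
  | succ n ih =>
    intro U past hU hI
    rcases U.eq_empty_or_nonempty with h0 | ⟨t₀, ht₀⟩
    · exact ih U past (by rw [h0, Set.ncard_empty]; exact Nat.zero_le _) hI
    obtain ⟨T, Q, htT, hTU, hT, htouch, hQc, hQT, hTQ, hQ⟩ := exists_core hW hr hI ht₀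
    have hS : 0 < 16 * r * Y := by positivity
    have hY' : (0 : ℝ) < Y := by exact_mod_cast hY
    have hr' : (0 : ℝ) < r := by exact_mod_cast hr0
    have hin : ∀ R < 16 * r * Y, HasDecomp G W (nbhd G W U T R) (6 * (16 * r * Y))
        fun u v => 2 * (W u v / Y) := by
      intro R hR
      have hTB : T ⊆ nbhd G W U T R := subset_nbhd hTU
      refine (hasDecomp_of_geodesics hW (conn_nbhd hW htT hTU hT) hS
        (φ := dst G W U t₀) (fun a ha b hb h => dst_lip_of_mem (nbhd_subset ha)
          (nbhd_subset hb) h) Q (fun P hP => (hQT P hP).trans hTB) hQ ?_).mono ?_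
      · rintro x ⟨t, ht, m, hm, hw⟩
        obtain ⟨P, hP, htP⟩ := hTQ t ht
        exact ⟨P, hP, t, htP, m, hm.trans hR.le, hw.in_nbhd ht hm⟩
      · intro u _ v _ _
        have h1 : ((Q.card * 7 : ℕ) : ℝ) ≤ r * 7 := by
          exact_mod_cast Nat.mul_le_mul_right 7 hQc
        have h2 : (0 : ℝ) ≤ W u v := Nat.cast_nonneg _
        push_cast at h1 ⊢
        rw [← mul_div_assoc, div_le_div_iff₀ (by positivity) hY']
        have h3 : (Q.card : ℝ) * 7 * (3 * W u v) * Y ≤ r * 7 * (3 * W u v) * Y := by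
          gcongr
        have h4 : (0 : ℝ) ≤ r * W u v * Y := by positivity
        linarith
    have hout : ∀ R, ∃ b, HasDecomp G W (U \ nbhd G W U T R) (6 * (16 * r * Y)) b ∧
        ∀ u ∈ U \ nbhd G W U T R, ∀ v ∈ U \ nbhd G W U T R, G.Adj u v → ∀ lu lv,
          Valid G W (U \ nbhd G W U T R) (insert (nbhd G W U T R) past) u lu →
          Valid G W (U \ nbhd G W U T R) (insert (nbhd G W U T R) past) v lv →
          b u v ≤ W u v / Y * (4 + 28 * (1 - pot Y lu - pot Y lv)) := by
      intro R
      refine ih _ _ ?_ (hI.step hW htT hTU hT htouch R)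
      have : (U \ nbhd G W U T R).ncard < U.ncard := by
        refine Set.ncard_lt_ncard ?_ (Set.toFinite U)
        refine ⟨Set.sdiff_subset, fun h => ?_⟩
        exact (h ht₀).2 (subset_nbhd hTU htT)
      omega
    choose b₂ hb₂ hb₂' using hout
    have hmix := HasDecomp.mix (q := fun R : Fin (16 * r * Y) => p R) (fun R => hp.nonneg R)
      (by rw [← Finset.sum_range]; exact hp.sum_eq)
      fun R => (hin R R.isLt).glue nbhd_subset (hb₂ R)
    refine ⟨_, hmix, ?_⟩
    intro u hu v hv huv lu lv hlu hlv
    obtain ⟨pu, hu1, hu2, hu3, hu4⟩ := vertex_step hW hY hp hI hr hu hTU ⟨t₀, htT⟩ hlu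
    obtain ⟨pv, hv1, hv2, hv3, hv4⟩ := vertex_step hW hY hp hI hr hv hTU ⟨t₀, htT⟩ hlv
    rw [← Finset.sum_range (fun R => p R * (if u ∈ nbhd G W U T R ∧ v ∈ nbhd G W U T R then
      2 * (W u v / Y : ℝ) else if u ∉ nbhd G W U T R ∧ v ∉ nbhd G W U T R then b₂ R u v else 1))]
    have hε : (1 / 14 : ℝ) * (1 / 2) ^ (16 * r) ≤ 1 / 56 * (1 / 8) ^ r * (2 / 3) ^ (16 * r) := by
      have h1 := (small_tail (r := r)).resolve_right hr0.ne'
      have h2 : ((1 : ℝ) / 2) ^ (16 * r) = (3 / 4) ^ (16 * r) * (2 / 3) ^ (16 * r) := by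
        rw [← mul_pow]; norm_num
      rw [h2, ← mul_assoc]
      exact mul_le_mul_of_nonneg_right h1 (by positivity)
    refine carve_cost hY hp (A := fun R => u ∈ nbhd G W U T R)
      (B := fun R => v ∈ nbhd G W U T R) (fun _ _ h h' => nbhd_mono h h')
      (fun _ _ h h' => nbhd_mono h h') (fun m h => ?_) (fun m h => nbhd_adj hu huv h) hε hu1 hv1
      hu3 hu4 hv3 hv4 ?_ ?_ ?_
    · have := nbhd_adj hv huv.symm h
      rwa [hW v u] at this
    · intro R _ h1 h2
      rw [if_pos ⟨h1, h2⟩]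
    · intro R _
      by_cases h1 : u ∈ nbhd G W U T R <;> by_cases h2 : v ∈ nbhd G W U T R <;> simp [h1, h2]
    · intro R _ h1 h2
      rw [if_neg fun h => h1 h.1, if_pos ⟨h1, h2⟩]
      obtain ⟨lu', hlu', hpu⟩ := hu2 R h1
      obtain ⟨lv', hlv', hpv⟩ := hv2 R h2
      refine (hb₂' R u ⟨hu, h1⟩ v ⟨hv, h2⟩ huv lu' lv' hlu' hlv').trans ?_
      exact mul_le_mul_of_nonneg_left (by linarith) (by positivity)

end MinorFree

namespace MinorFree

variable {V : Type} {G : SimpleGraph V} {W : V → V → ℕ}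

lemma Wk.exists_walk {w : Sym2 V → ℝ} {h : ℝ} (hw : ∀ x y, w s(x, y) ≤ h * W x y) {C : Set V}
    {x y : V} {n : ℕ} (hk : Wk G W C x y n) : ∃ q : (G.induce C).Walk ⟨x, hk.left_mem⟩
      ⟨y, hk.right_mem⟩, Pad.walkWeightI w q ≤ h * n := by
  induction hk with
  | nil _ => exact ⟨.nil, by simp [Pad.walkWeightI]⟩
  | @cons x y z n h1 h2 h3 ih =>
    obtain ⟨q, hq⟩ := ih
    have hadj : (G.induce C).Adj ⟨x, h1⟩ ⟨y, h3.left_mem⟩ := h2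
    refine ⟨.cons hadj q, ?_⟩
    have := hw x y
    simp only [Pad.walkWeightI, SimpleGraph.Walk.darts_cons, List.map_cons, List.sum_cons,
      SimpleGraph.Dart.edge_mk, Sym2.map_mk] at hq ⊢
    push_cast
    linarith

/-- Rounding of the weights to multiples of a small unit, up to a factor two. -/
lemma exists_rounding [Fintype V] {w : Sym2 V → ℝ} (hw : ∀ e, 0 ≤ w e) {a : ℝ} (ha : 0 < a) :
    ∃ (Y : ℕ) (W : V → V → ℕ), 0 < Y ∧ (∀ x y, W x y = W y x) ∧
      ∀ x y, w s(x, y) ≤ a / Y * W x y ∧ a / Y * W x y ≤ 2 * w s(x, y) := by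
  classical
  obtain ⟨m, hm, hmw⟩ : ∃ m : ℝ, 0 < m ∧ ∀ e, 0 < w e → m ≤ w e := by
    rcases (Finset.univ.filter fun e => 0 < w e).eq_empty_or_nonempty with h0 | h0
    · exact ⟨1, one_pos, fun e he =>
        absurd he (Finset.filter_eq_empty_iff.1 h0 (Finset.mem_univ e))⟩
    · obtain ⟨e, he, h⟩ := Finset.exists_min_image _ w h0
      exact ⟨w e, (Finset.mem_filter.1 he).2,
        fun e' he' => h e' (Finset.mem_filter.2 ⟨Finset.mem_univ _, he'⟩)⟩
  obtain ⟨Y, hY⟩ := exists_nat_gt (a / m)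
  have hY0 : (0 : ℝ) < Y := lt_trans (by positivity) hY
  have hY1 : a / Y ≤ m := by
    rw [div_lt_iff₀ hm] at hY
    rw [div_le_iff₀ hY0]
    linarith
  have hh : 0 < a / Y := by positivity
  refine ⟨Y, fun x y => ⌈w s(x, y) / (a / Y)⌉₊, by exact_mod_cast hY0,
    fun x y => by dsimp only; rw [Sym2.eq_swap], fun x y => ?_⟩
  dsimp only
  have h1 := Nat.le_ceil (w s(x, y) / (a / Y))
  refine ⟨?_, ?_⟩
  · rw [div_le_iff₀ hh] at h1
    linarith
  · rcases (hw s(x, y)).eq_or_lt with h0 | h0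
    · rw [← h0]; simp
    · have h2 := (Nat.ceil_lt_add_one (div_nonneg h0.le hh.le)).le
      have h3 := hmw _ h0
      have h4 := mul_le_mul_of_nonneg_left h2 hh.le
      rw [mul_add, mul_div_cancel₀ _ hh.ne', mul_one] at h4
      linarith

lemma inv_univ : Inv G W Set.univ ∅ :=
  ⟨fun _ h => absurd h (Set.notMem_empty _), fun _ h => absurd h (Set.notMem_empty _),
    fun _ h => absurd h (Set.notMem_empty _), fun _ h => absurd h (Set.notMem_empty _)⟩

open Classical in
lemma exists_edge_decomp [Fintype V] {w : Sym2 V → ℝ} (hw : ∀ e, 0 ≤ w e) {r : ℕ} (hr0 : 0 < r)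
    (hr : ¬ Pad.HasCliqueMinor G r) {Δ : ℝ} (hΔ : 0 < Δ) :
    ∃ (Ω : Type) (_ : Fintype Ω) (p : Ω → ℝ) (P : Ω → Pad.Partition V),
      (∀ ω, 0 ≤ p ω) ∧ ∑ ω, p ω = 1 ∧ (∀ ω, (P ω).StronglyBounded w G Δ) ∧
      ∀ u v, G.Adj u v → ∑ ω, (if (P ω).cl u ≠ (P ω).cl v then p ω else 0) ≤
        6144 * r / Δ * w s(u, v) := by
  have hr' : (0 : ℝ) < r := by exact_mod_cast hr0
  obtain ⟨Y, W, hY, hW, hWw⟩ := exists_rounding hw (a := Δ / (96 * r)) (by positivity)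
  have hY' : (0 : ℝ) < Y := by exact_mod_cast hY
  obtain ⟨p, hp⟩ := exists_isTexp (N := 16 * r) (by positivity) hY
  obtain ⟨b, ⟨Ω, _, q, f, hq, hq1, hf, hcut⟩, hb⟩ :=
    exists_hasDecomp hW hr hr0 hY hp _ Set.univ ∅ le_rfl inv_univ
  refine ⟨Ω, inferInstance, q, fun ω => ⟨f ω, fun v => (hf ω v trivial).1,
    fun u v h => (hf ω v trivial).2.2.1 u h⟩, hq, hq1, ?_, ?_⟩
  · rintro ω v ⟨x, hx⟩ ⟨y, hy⟩
    obtain ⟨m, hm, hk⟩ := (hf ω v trivial).2.2.2 x hx y hy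
    obtain ⟨s, hs⟩ := hk.exists_walk (w := w) fun x y => (hWw x y).1
    refine ⟨s, hs.trans ?_⟩
    have hm' : (m : ℝ) ≤ 6 * (16 * r * Y) := by exact_mod_cast hm
    calc Δ / (96 * r) / Y * m ≤ Δ / (96 * r) / Y * (6 * (16 * r * Y)) := by gcongr
      _ = Δ := by field_simp; norm_num
  · intro u v huv
    have hnil : ∀ x, Valid G W Set.univ ∅ x [] := fun x =>
      ⟨by simp, by simp, by simp⟩
    have h1 := (hcut u trivial v trivial huv).trans
      (hb u trivial v trivial huv [] [] (hnil u) (hnil v))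
    refine h1.trans ?_
    have h2 := (hWw u v).2
    have h3 : (W u v : ℝ) / Y = 96 * r / Δ * (Δ / (96 * r) / Y * W u v) := by field_simp
    have h4 : 96 * r / Δ * (Δ / (96 * r) / Y * W u v) ≤ 96 * r / Δ * (2 * w s(u, v)) := by
      gcongr
    have h5 : (6144 : ℝ) * r / Δ * w s(u, v) = 32 * (96 * r / Δ * (2 * w s(u, v))) := by ring
    simp only [pot]
    linarith

open Classical in
/-- A bound on the cut probability of edges extends to all pairs. -/
lemma cut_le_wdist {Ω : Type} [Fintype Ω] {p : Ω → ℝ} {P : Ω → Pad.Partition V} {w : Sym2 V → ℝ}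
    (hG : G.Connected) (hp : ∀ ω, 0 ≤ p ω) {c : ℝ} (hc : 0 < c)
    (h : ∀ u v, G.Adj u v →
      ∑ ω, (if (P ω).cl u ≠ (P ω).cl v then p ω else 0) ≤ c * w s(u, v)) (u v : V) :
    ∑ ω, (if (P ω).cl u ≠ (P ω).cl v then p ω else 0) ≤ c * Pad.wdist w G u v := by
  have key : ∀ {u v : V} (q : G.Walk u v),
      ∑ ω, (if (P ω).cl u ≠ (P ω).cl v then p ω else 0) ≤ c * Pad.walkWeight w q := by
    intro u v q
    induction q with
    | nil => simp [Pad.walkWeight]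
    | @cons x y z hxy q ih =>
      have h1 := h x y hxy
      have h2 : ∑ ω, (if (P ω).cl x ≠ (P ω).cl z then p ω else 0) ≤
          ∑ ω, (if (P ω).cl x ≠ (P ω).cl y then p ω else 0) +
          ∑ ω, (if (P ω).cl y ≠ (P ω).cl z then p ω else 0) := by
        rw [← Finset.sum_add_distrib]
        refine Finset.sum_le_sum fun ω _ => ?_
        have := hp ω
        by_cases hxy : (P ω).cl x = (P ω).cl y
        · simp [hxy]
        · simp only [ne_eq, hxy, not_false_eq_true, if_true]
          split_ifs <;> linarith
      simp only [Pad.walkWeight, SimpleGraph.Walk.darts_cons, List.map_cons, List.sum_cons,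
        SimpleGraph.Dart.edge_mk] at ih ⊢
      linarith
  rw [← div_le_iff₀' hc]
  obtain ⟨q⟩ := hG.preconnected u v
  refine le_csInf ⟨_, q, rfl⟩ ?_
  rintro _ ⟨q, rfl⟩
  rw [div_le_iff₀' hc]
  exact key q

end MinorFree

/-- `K_r`-minor-free graphs admit strongly `(c·r, Δ)`-separating
decompositions for every `Δ > 0`, for a universal constant `c > 0`. -/
theorem minor_free_separating_decomposition :
    ∃ c : ℝ, 0 < c ∧
      ∀ (V : Type) [Fintype V], ∀ (G : SimpleGraph V), G.Connected →
      ∀ w : Sym2 V → ℝ, (∀ e, 0 ≤ w e) →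
      ∀ r : ℕ, 2 ≤ r → ¬ Pad.HasCliqueMinor G r →
      ∀ Δ : ℝ, 0 < Δ →
      ∃ D : PMF (Pad.Partition V),
        (∀ P ∈ D.support, Pad.Partition.StronglyBounded w G P Δ) ∧
        ∀ u v : V,
          D.toOuterMeasure {P | P.cl u ≠ P.cl v} ≤
            ENNReal.ofReal (c * r * Pad.wdist w G u v / Δ) := by
  classical
  refine ⟨6144, by norm_num, fun V _ G hG w hw r hr2 hr Δ hΔ => ?_⟩
  have hr0 : 0 < r := by omega
  have hr' : (0 : ℝ) < r := by exact_mod_cast hr0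
  obtain ⟨Ω, _, p, P, hp, hp1, hP, hcut⟩ := MinorFree.exists_edge_decomp hw hr0 hr hΔ
  have hsum : ∑ ω, ENNReal.ofReal (p ω) = 1 := by
    rw [← ENNReal.ofReal_sum_of_nonneg fun ω _ => hp ω, hp1, ENNReal.ofReal_one]
  refine ⟨(PMF.ofFintype (fun ω => ENNReal.ofReal (p ω)) hsum).map P, ?_, fun u v => ?_⟩
  · intro Q hQ
    obtain ⟨ω, -, rfl⟩ := (PMF.mem_support_map_iff _ _ _).1 hQ
    exact hP ω
  · have h1 := MinorFree.cut_le_wdist hG hp (c := 6144 * r / Δ) (by positivity) hcut u v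
    have h2 : (6144 : ℝ) * r * Pad.wdist w G u v / Δ = 6144 * r / Δ * Pad.wdist w G u v := by
      ring
    rw [h2, PMF.toOuterMeasure_map_apply, PMF.toOuterMeasure_apply_fintype]
    refine le_trans (le_of_eq ?_) (ENNReal.ofReal_le_ofReal h1)
    rw [ENNReal.ofReal_sum_of_nonneg fun ω _ => by split_ifs <;> simp [hp ω]]
    refine Finset.sum_congr rfl fun ω _ => ?_
    by_cases h : (P ω).cl u = (P ω).cl v <;> simp [Set.indicator, h]
end

section
/- There exists a universal constant c > 0 such that for every weighted graph G = (V, E, w) with doubling dimension ddim ≥ 1 and every Δ > 0, G admits a strongly (c · ddim, Δ)-separating decomposition: a probability distribution D over partitions of V such that every partition in the support of D is strongly Δ-bounded and for every pair u, v ∈ V, Pr_{P∼D}[P(u) ≠ P(v)] ≤ c · ddim · d_G(u, v)/Δ. -/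
open MeasureTheory

namespace Pad

section Distance

variable {V : Type*} {w : Sym2 V → ℝ} {G : SimpleGraph V}

theorem walkWeight_nonneg (hw : ∀ e, 0 ≤ w e) {u v : V} (p : G.Walk u v) :
    0 ≤ walkWeight w p := by
  refine List.sum_nonneg fun x hx => ?_
  obtain ⟨d, -, rfl⟩ := List.mem_map.1 hx
  exact hw _

theorem walkWeight_append {u v x : V} (p : G.Walk u v) (q : G.Walk v x) :
    walkWeight w (p.append q) = walkWeight w p + walkWeight w q := by
  simp [walkWeight]

theorem walkWeight_reverse {u v : V} (p : G.Walk u v) :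
    walkWeight w p.reverse = walkWeight w p := by
  simp [walkWeight, List.map_reverse, List.sum_reverse, Function.comp_def]

theorem walkWeightI_append {C : Set V} {u v x : C} (p : (G.induce C).Walk u v)
    (q : (G.induce C).Walk v x) :
    walkWeightI w (p.append q) = walkWeightI w p + walkWeightI w q := by
  simp [walkWeightI]

theorem walkWeightI_reverse {C : Set V} {u v : C} (p : (G.induce C).Walk u v) :
    walkWeightI w p.reverse = walkWeightI w p := by
  simp [walkWeightI, List.map_reverse, List.sum_reverse, Function.comp_def]

theorem walkWeightI_induce {C : Set V} {u v : V} (p : G.Walk u v)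
    (hp : ∀ x ∈ p.support, x ∈ C) : walkWeightI w (p.induce C hp) = walkWeight w p := by
  induction p with
  | nil => simp [walkWeightI, walkWeight]
  | cons h p ih =>
    have := ih fun x hx => hp x (by simp [hx])
    simp only [walkWeightI, walkWeight] at this ⊢
    simp only [SimpleGraph.Walk.induce_cons, SimpleGraph.Walk.darts_cons, List.map_cons,
      List.sum_cons, this]
    rfl

theorem wdist_le_walkWeight (hw : ∀ e, 0 ≤ w e) {u v : V} (p : G.Walk u v) :
    wdist w G u v ≤ walkWeight w p := by
  refine csInf_le ⟨0, ?_⟩ ⟨p, rfl⟩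
  rintro x ⟨q, rfl⟩
  exact walkWeight_nonneg hw q

theorem wdist_nonneg (hw : ∀ e, 0 ≤ w e) (u v : V) : 0 ≤ wdist w G u v := by
  refine Real.sInf_nonneg ?_
  rintro x ⟨q, rfl⟩
  exact walkWeight_nonneg hw q

theorem wdist_self (hw : ∀ e, 0 ≤ w e) (u : V) : wdist w G u u = 0 :=
  le_antisymm ((wdist_le_walkWeight hw (.nil : G.Walk u u)).trans (by simp [walkWeight]))
    (wdist_nonneg hw u u)

theorem wdist_comm (u v : V) : wdist w G u v = wdist w G v u := by
  unfold wdist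
  congr 1
  ext x
  constructor <;> rintro ⟨p, rfl⟩ <;> exact ⟨p.reverse, (walkWeight_reverse p).symm⟩

/-- The shortest-path distance is attained by a walk. -/
theorem exists_walkWeight_eq_wdist [Finite V] (hG : G.Connected) (hw : ∀ e, 0 ≤ w e) (u v : V) :
    ∃ p : G.Walk u v, walkWeight w p = wdist w G u v := by
  classical
  have := Fintype.ofFinite V
  have : Nonempty (G.Path u v) := ⟨⟨(hG u v).some.bypass, SimpleGraph.Walk.bypass_isPath _⟩⟩
  obtain ⟨p, hp⟩ := Finite.exists_min fun p : G.Path u v => walkWeight w p.1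
  refine ⟨p.1, le_antisymm ?_ (wdist_le_walkWeight hw _)⟩
  refine le_csInf ⟨_, p.1, rfl⟩ ?_
  rintro x ⟨q, rfl⟩
  refine (hp ⟨q.bypass, SimpleGraph.Walk.bypass_isPath _⟩).trans ?_
  refine (q.darts_bypass_sublist_darts.map _).sum_le_sum fun x hx => ?_
  obtain ⟨d, -, rfl⟩ := List.mem_map.1 hx
  exact hw _

theorem wdist_triangle [Finite V] (hG : G.Connected) (hw : ∀ e, 0 ≤ w e) (x y z : V) :
    wdist w G x z ≤ wdist w G x y + wdist w G y z := by
  obtain ⟨p, hp⟩ := exists_walkWeight_eq_wdist hG hw x y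
  obtain ⟨q, hq⟩ := exists_walkWeight_eq_wdist hG hw y z
  rw [← hp, ← hq, ← walkWeight_append]
  exact wdist_le_walkWeight hw _

/-- A walk realizing the distance passes only through vertices lying metrically between
its endpoints. -/
theorem exists_geodesic [Finite V] (hG : G.Connected) (hw : ∀ e, 0 ≤ w e) (u v : V) :
    ∃ p : G.Walk u v, walkWeight w p = wdist w G u v ∧
      ∀ x ∈ p.support, wdist w G u x + wdist w G x v ≤ wdist w G u v := by
  classical
  obtain ⟨p, hp⟩ := exists_walkWeight_eq_wdist hG hw u v
  refine ⟨p, hp, fun x hx => ?_⟩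
  rw [← hp, ← p.take_spec hx, walkWeight_append]
  exact add_le_add (wdist_le_walkWeight hw _) (wdist_le_walkWeight hw _)

/-- If every vertex of `C` reaches the centre `t` by a short geodesic inside `C`, then `C` has
small strong diameter. -/
theorem StronglyBounded.of_center [Finite V] (hG : G.Connected) (hw : ∀ e, 0 ≤ w e)
    {C : Set V} {t : V} {R : ℝ} (hR : ∀ x ∈ C, wdist w G x t ≤ R)
    (hC : ∀ x ∈ C, ∀ y, wdist w G x y + wdist w G y t ≤ wdist w G x t → y ∈ C) :
    StronglyBounded w G C (2 * R) := by
  have key : ∀ x : C, ∃ h : t ∈ C, ∃ p : (G.induce C).Walk x ⟨t, h⟩, walkWeightI w p ≤ R := by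
    intro x
    obtain ⟨p, hp, hs⟩ := exists_geodesic hG hw x.1 t
    have hpC : ∀ y ∈ p.support, y ∈ C := fun y hy => hC x x.2 y (hs y hy)
    exact ⟨hpC t p.end_mem_support, p.induce C hpC,
      (walkWeightI_induce p hpC).trans_le (hp.trans_le (hR x x.2))⟩
  intro u v
  obtain ⟨_, p, hp⟩ := key u
  obtain ⟨_, q, hq⟩ := key v
  refine ⟨p.append q.reverse, ?_⟩
  rw [walkWeightI_append, walkWeightI_reverse]
  linarith

/-- A maximal separated subset of `V` is a net. -/
theorem exists_net [Finite V] (hw : ∀ e, 0 ≤ w e) {r : ℝ} (hr : 0 ≤ r) :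
    ∃ N : Set V, (∀ s ∈ N, ∀ t ∈ N, s ≠ t → r < wdist w G s t) ∧
      ∀ x, ∃ t ∈ N, wdist w G t x ≤ r := by
  obtain ⟨N, -, hN⟩ := Finite.exists_le_maximal (α := Set V)
    (p := fun N => ∀ s ∈ N, ∀ t ∈ N, s ≠ t → r < wdist w G s t) (a := ∅) (by simp)
  refine ⟨N, hN.prop, fun x => ?_⟩
  by_contra! h
  have hx : x ∈ N := by
    refine hN.le_of_ge (y := insert x N) ?_ (Set.subset_insert x N) (Set.mem_insert x N)
    rintro s (rfl | hs) t (rfl | ht) hst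
    · exact absurd rfl hst
    · rw [wdist_comm]; exact h t ht
    · exact h s hs
    · exact hN.prop s hs t ht hst
  exact absurd (h x hx) (by rw [wdist_self hw]; exact not_lt.2 hr)

/-- In a doubling metric, a ball of radius `4 * r` contains few points of a `2 * r`-separated
set. -/
theorem Doubling.ncard_separated_le [Finite V] (hG : G.Connected) (hw : ∀ e, 0 ≤ w e)
    {ddim : ℝ} (hd : Doubling w G ddim) {r : ℝ} (hr : 0 < r) {N : Set V}
    (hN : ∀ s ∈ N, ∀ t ∈ N, s ≠ t → 2 * r < wdist w G s t) (x : V) :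
    ((N ∩ ball w G x (4 * r)).ncard : ℝ) ≤ 2 ^ (2 * ddim) := by
  classical
  obtain ⟨T, hTf, hT, hTc⟩ := hd x (2 * r) (by positivity)
  choose S hSf hS hSc using fun y => hd y r hr
  set U : Finset V := hTf.toFinset.biUnion fun y => (hSf y).toFinset with hU
  have hUcard : (U.card : ℝ) ≤ 2 ^ (2 * ddim) := by
    have h1 : (U.card : ℝ) ≤ ∑ y ∈ hTf.toFinset, ((hSf y).toFinset.card : ℝ) := by
      exact_mod_cast Finset.card_biUnion_le
    refine h1.trans ((Finset.sum_le_card_nsmul _ _ ((2 : ℝ) ^ ddim) fun y _ => ?_).trans ?_)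
    · rw [← Set.ncard_eq_toFinset_card _ (hSf y)]; exact hS y
    · rw [nsmul_eq_mul, ← Set.ncard_eq_toFinset_card _ hTf, two_mul,
        Real.rpow_add two_pos]
      gcongr
  have hcov : ∀ t ∈ N ∩ ball w G x (4 * r), ∃ z ∈ U, wdist w G z t ≤ r := by
    rintro t ⟨-, ht⟩
    obtain ⟨y, hy, hty⟩ := Set.mem_iUnion₂.1
      (hTc (show t ∈ ball w G x (2 * (2 * r)) by rwa [← mul_assoc, show (2 : ℝ) * 2 = 4 by norm_num]))
    obtain ⟨z, hz, htz⟩ := Set.mem_iUnion₂.1 (hSc y hty)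
    exact ⟨z, by simpa [hU] using ⟨y, hy, hz⟩, htz⟩
  choose! f hfU hf using hcov
  refine le_trans ?_ hUcard
  rw [← Set.ncard_coe_finset]
  refine Nat.cast_le.2 (Set.ncard_le_ncard_of_injOn f hfU ?_)
  intro s hs t ht hst
  by_contra hne
  have h1 := hN s hs.1 t ht.1 hne
  have h2 := wdist_triangle hG hw s (f s) t
  have h3 := hf s hs
  have h4 := hf t ht
  rw [wdist_comm] at h3
  rw [← hst] at h4
  linarith

end Distance

end Pad

namespace Pad

section Resampling

variable {ι κ : Type*} [Fintype ι] [DecidableEq ι] [Fintype κ]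

/-- Under a product distribution, resampling one coordinate does not change expectations. -/
theorem sum_prod_mul_resample {p : κ → ℝ} (hp : ∑ k, p k = 1) (t : ι) (g : (ι → κ) → ℝ) :
    ∑ ω : ι → κ, (∏ i, p (ω i)) * ∑ k, p k * g (Function.update ω t k) =
      ∑ ω : ι → κ, (∏ i, p (ω i)) * g ω := by
  have hW : ∀ a : κ × ({j // j ≠ t} → κ),
      ∏ i, p ((Equiv.funSplitAt t κ).symm a i) = p a.1 * ∏ j, p (a.2 j) := by
    intro a
    rw [Fintype.prod_eq_mul_prod_subtype_ne _ t]
    congr 1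
    · simp [Equiv.funSplitAt, Equiv.piSplitAt]
    · exact Finset.prod_congr rfl fun j _ => by
        simp [Equiv.funSplitAt, Equiv.piSplitAt, j.2]
  have hu : ∀ (a : κ × ({j // j ≠ t} → κ)) (k : κ),
      Function.update ((Equiv.funSplitAt t κ).symm a) t k =
        (Equiv.funSplitAt t κ).symm (k, a.2) := by
    intro a k
    ext j
    by_cases h : j = t
    · subst h; simp [Equiv.funSplitAt, Equiv.piSplitAt]
    · simp [Equiv.funSplitAt, Equiv.piSplitAt, h]
  rw [← (Equiv.funSplitAt t κ).symm.sum_comp, ← (Equiv.funSplitAt t κ).symm.sum_comp]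
  simp only [hW, hu]
  rw [Fintype.sum_prod_type, Fintype.sum_prod_type_right]
  simp only [mul_assoc, ← Finset.mul_sum]
  rw [← Finset.sum_mul, hp, one_mul]
  refine Finset.sum_congr rfl fun r _ => ?_
  rw [Finset.mul_sum]
  exact Finset.sum_congr rfl fun k _ => by ring

theorem sum_prod_eq_one {p : κ → ℝ} (hp : ∑ k, p k = 1) :
    ∑ ω : ι → κ, ∏ i, p (ω i) = 1 := by
  rw [← Fintype.prod_sum fun _ : ι => p]
  simp [hp]

end Resampling

section TruncatedGeometric

/-- The truncated geometric distribution on `{0, …, K - 1}`. -/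
noncomputable def truncGeom (q : ℝ) (K : ℕ) (i : Fin K) : ℝ :=
  q ^ (i : ℕ) / ∑ j : Fin K, q ^ (j : ℕ)

theorem sum_fin_pow_pos {q : ℝ} (hq : 0 < q) {K : ℕ} (hK : 0 < K) :
    0 < ∑ j : Fin K, q ^ (j : ℕ) :=
  Finset.sum_pos (fun _ _ => pow_pos hq _) ⟨⟨0, hK⟩, Finset.mem_univ _⟩

theorem truncGeom_nonneg {q : ℝ} (hq : 0 < q) {K : ℕ} (i : Fin K) : 0 ≤ truncGeom q K i :=
  div_nonneg (pow_nonneg hq.le _) (Finset.sum_nonneg fun _ _ => pow_nonneg hq.le _)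

theorem sum_truncGeom {q : ℝ} (hq : 0 < q) {K : ℕ} (hK : 0 < K) :
    ∑ i, truncGeom q K i = 1 := by
  simp only [truncGeom]
  rw [← Finset.sum_div, div_self (sum_fin_pow_pos hq hK).ne']

/-- Near-memorylessness: the lowest `m` values of an upper set `A` have mass at most
`m * (1 - q)` times the mass of `A`, up to a truncation error. -/
theorem sum_truncGeom_lowest_le {q : ℝ} (hq : 0 < q) (hq1 : q < 1) {K : ℕ} (m : ℕ)
    {A B : Finset (Fin K)} (hA : ∀ i ∈ A, ∀ j, i ≤ j → j ∈ A) (hBA : B ⊆ A)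
    (hB : ∀ k ∈ B, ∀ i ∈ A, ¬ (i : ℕ) + m ≤ k) :
    ∑ k ∈ B, truncGeom q K k ≤
      m * ((1 - q) * ∑ k ∈ A, truncGeom q K k + q ^ K / ∑ j : Fin K, q ^ (j : ℕ)) := by
  have hZ : 0 ≤ ∑ j : Fin K, q ^ (j : ℕ) := Finset.sum_nonneg fun _ _ => pow_nonneg hq.le _
  simp only [truncGeom]
  rw [← Finset.sum_div, ← Finset.sum_div, ← mul_div_assoc, ← add_div, ← mul_div_assoc]
  refine div_le_div_of_nonneg_right ?_ hZ
  rcases A.eq_empty_or_nonempty with rfl | hne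
  · rw [Finset.subset_empty.1 hBA]
    simp only [Finset.sum_empty, mul_zero, zero_add]
    positivity
  set a := A.min' hne with ha
  have haA : a ∈ A := A.min'_mem hne
  have hAeq : A.map Fin.valEmbedding = Finset.Ico (a : ℕ) K := by
    ext i
    simp only [Finset.mem_map, Fin.valEmbedding_apply, Finset.mem_Ico]
    constructor
    · rintro ⟨k, hk, rfl⟩
      exact ⟨A.min'_le k hk, k.2⟩
    · rintro ⟨h1, h2⟩
      exact ⟨⟨i, h2⟩, hA a haA _ h1, rfl⟩
  have hsumA : ∑ k ∈ A, q ^ (k : ℕ) = ∑ i ∈ Finset.Ico (a : ℕ) K, q ^ i := by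
    rw [← hAeq, Finset.sum_map]; rfl
  have hgeom : (1 - q) * ∑ k ∈ A, q ^ (k : ℕ) + q ^ K = q ^ (a : ℕ) := by
    rw [hsumA, geom_sum_Ico hq1.ne a.2.le]
    have : q - 1 ≠ 0 := by linarith
    field_simp
    ring
  have hcard : (B.card : ℝ) ≤ m := by
    have h : B.map Fin.valEmbedding ⊆ Finset.Ico (a : ℕ) (a + m) := by
      intro i
      simp only [Finset.mem_map, Fin.valEmbedding_apply, Finset.mem_Ico]
      rintro ⟨k, hk, rfl⟩
      exact ⟨A.min'_le k (hBA hk), not_le.1 (hB k hk a haA)⟩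
    have := Finset.card_le_card h
    simp only [Finset.card_map, Nat.card_Ico, Nat.add_sub_cancel_left] at this
    exact_mod_cast this
  rw [hgeom]
  calc ∑ k ∈ B, q ^ (k : ℕ) ≤ B.card • q ^ (a : ℕ) :=
        Finset.sum_le_card_nsmul _ _ _ fun k hk =>
          pow_le_pow_of_le_one hq.le hq1.le (A.min'_le k (hBA hk))
    _ = B.card * q ^ (a : ℕ) := nsmul_eq_mul _ _
    _ ≤ m * q ^ (a : ℕ) := by gcongr

variable {ι : Type*} [Fintype ι] [DecidableEq ι]

open Classical in
/-- Consider independent truncated geometric bids and a winner rule for which raising the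
winning bid does not change the winner. The probability that the winner would lose whenever its
bid is lowered by `m` or more is about `m * (1 - q)`. -/
theorem sum_fragile_winner_le {q : ℝ} (hq : 0 < q) (hq1 : q < 1) {K : ℕ} (hK : 0 < K)
    (win : (ι → Fin K) → ι)
    (hmono : ∀ ω i, ω (win ω) ≤ i → win (Function.update ω (win ω) i) = win ω)
    (S : Finset ι) (hS : ∀ ω, win ω ∈ S) (m : ℕ) :
    ∑ ω with ∀ i : Fin K, (i : ℕ) + m ≤ ω (win ω) →
        win (Function.update ω (win ω) i) ≠ win ω, ∏ j, truncGeom q K (ω j) ≤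
      m * ((1 - q) + S.card * (q ^ K / ∑ j : Fin K, q ^ (j : ℕ))) := by
  set W : (ι → Fin K) → ℝ := fun ω => ∏ j, truncGeom q K (ω j) with hW
  set c : ℝ := q ^ K / ∑ j : Fin K, q ^ (j : ℕ) with hc
  have hp := sum_truncGeom hq hK
  have hW0 : ∀ ω, 0 ≤ W ω := fun ω => Finset.prod_nonneg fun j _ => truncGeom_nonneg hq _
  obtain ⟨F, hF⟩ : ∃ F : ι → (ι → Fin K) → Prop, ∀ t ω, F t ω ↔ win ω = t ∧
      ∀ i : Fin K, (i : ℕ) + m ≤ ω t → win (Function.update ω t i) ≠ t :=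
    ⟨_, fun _ _ => Iff.rfl⟩
  have hfib : ∀ t ω, ∑ k, truncGeom q K k * (if F t (Function.update ω t k) then 1 else 0) ≤
      m * ((1 - q) * ∑ k, truncGeom q K k *
        (if win (Function.update ω t k) = t then 1 else 0) + c) := by
    intro t ω
    simp only [mul_ite, mul_one, mul_zero, ← Finset.sum_filter]
    refine sum_truncGeom_lowest_le hq hq1 m ?_ ?_ ?_
    · intro i hi j hij
      simp only [Finset.mem_filter, Finset.mem_univ, true_and] at hi ⊢
      have := hmono (Function.update ω t i) j
      rw [hi] at this
      simpa using this (by simpa using hij)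
    · intro k
      simp only [Finset.mem_filter, Finset.mem_univ, true_and, hF]
      exact fun h => h.1
    · intro k hk i hi hik
      simp only [Finset.mem_filter, Finset.mem_univ, true_and, hF] at hk hi
      exact hk.2 i (by simpa using hik) (by simpa using hi)
  have ht : ∀ t, ∑ ω, W ω * (if F t ω then 1 else 0) ≤
      m * ((1 - q) * ∑ ω, W ω * (if win ω = t then 1 else 0) + c) := by
    intro t
    rw [← sum_prod_mul_resample hp t, ← sum_prod_mul_resample hp t fun ω =>
      if win ω = t then (1 : ℝ) else 0]
    calc _ ≤ ∑ ω, W ω * (m * ((1 - q) * ∑ k, truncGeom q K k *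
        (if win (Function.update ω t k) = t then 1 else 0) + c)) :=
          Finset.sum_le_sum fun ω _ => mul_le_mul_of_nonneg_left (hfib t ω) (hW0 ω)
      _ = m * ((1 - q) * ∑ ω, W ω * ∑ k, truncGeom q K k *
        (if win (Function.update ω t k) = t then 1 else 0) + c * ∑ ω, W ω) := by
          simp only [Finset.mul_sum, mul_add, Finset.sum_add_distrib]
          congr 1
          · refine Finset.sum_congr rfl fun ω _ => Finset.sum_congr rfl fun k _ => ?_
            ring
          · refine Finset.sum_congr rfl fun ω _ => ?_
            ring
      _ = _ := by rw [show ∑ ω, W ω = 1 from sum_prod_eq_one hp, mul_one]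
  calc _ = ∑ t ∈ S, ∑ ω, W ω * (if F t ω then 1 else 0) := by
        rw [Finset.sum_comm, Finset.sum_filter]
        refine Finset.sum_congr rfl fun ω _ => ?_
        rw [Finset.sum_eq_single_of_mem (win ω) (hS ω)]
        · simp [hF, hW]
        · intro t _ htne
          simp [hF, htne.symm]
    _ ≤ ∑ t ∈ S, m * ((1 - q) * ∑ ω, W ω * (if win ω = t then 1 else 0) + c) :=
        Finset.sum_le_sum fun t _ => ht t
    _ = m * ((1 - q) * ∑ t ∈ S, ∑ ω, W ω * (if win ω = t then 1 else 0) + S.card * c) := by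
        rw [← Finset.mul_sum, Finset.sum_add_distrib, ← Finset.mul_sum, Finset.sum_const,
          nsmul_eq_mul]
    _ = m * ((1 - q) + S.card * c) := by
        rw [Finset.sum_comm]
        have : ∀ ω, ∑ t ∈ S, W ω * (if win ω = t then 1 else 0) = W ω := fun ω => by
          rw [Finset.sum_eq_single_of_mem (win ω) (hS ω)]
          · simp
          · intro t _ htne
            simp [htne.symm]
        rw [Finset.sum_congr rfl fun ω _ => this ω, show ∑ ω, W ω = 1 from sum_prod_eq_one hp,
          mul_one]

/-- With success probability `2 * a / K` and at most `2 ^ (2 * a)` bidders, the truncation error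
in `sum_fragile_winner_le` is dominated by the main term. -/
theorem truncation_error_le {a : ℝ} (ha : 1 ≤ a) {K : ℕ} (hK : 2 * a < K) {n : ℕ}
    (hn : (n : ℝ) ≤ 2 ^ (2 * a)) :
    n * ((1 - 2 * a / K) ^ K / ∑ j : Fin K, (1 - 2 * a / K) ^ (j : ℕ)) ≤ 2 * (2 * a / K) := by
  have hK0 : (0 : ℝ) < K := by linarith
  set x : ℝ := 2 * a / K with hx
  have hx0 : 0 < x := by positivity
  have hx1 : x < 1 := (div_lt_one hK0).2 hK
  have hexp : (1 - x) ^ K ≤ Real.exp (-(2 * a)) := by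
    calc (1 - x) ^ K ≤ Real.exp (-x) ^ K :=
          pow_le_pow_left₀ (by linarith) (by linarith [Real.add_one_le_exp (-x)]) K
      _ = Real.exp (-(2 * a)) := by
          rw [← Real.exp_nat_mul]
          congr 1
          rw [hx]
          field_simp
  have hhalf : (1 - x) ^ K ≤ 1 / 2 := by
    refine hexp.trans ?_
    rw [Real.exp_neg, inv_eq_one_div]
    exact one_div_le_one_div_of_le two_pos (by linarith [Real.add_one_le_exp (2 * a)])
  have hn1 : n * (1 - x) ^ K ≤ 1 := by
    calc (n : ℝ) * (1 - x) ^ K ≤ Real.exp (2 * a) * Real.exp (-(2 * a)) := by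
          gcongr
          refine hn.trans ?_
          rw [← Real.exp_one_rpow]
          gcongr
          linarith [Real.add_one_le_exp 1]
      _ = 1 := by rw [← Real.exp_add]; simp
  have hZ : x * ∑ j : Fin K, (1 - x) ^ (j : ℕ) = 1 - (1 - x) ^ K := by
    rw [Fin.sum_univ_eq_sum_range fun j => (1 - x) ^ j]
    have := mul_neg_geom_sum (1 - x) K
    rwa [sub_sub_cancel] at this
  have hZ0 : 0 < ∑ j : Fin K, (1 - x) ^ (j : ℕ) :=
    sum_fin_pow_pos (by linarith) (by exact_mod_cast hK0)
  rw [← mul_div_assoc, div_le_iff₀ hZ0, mul_assoc, hZ]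
  linarith

end TruncatedGeometric

end Pad

namespace Pad

section Winner

variable {V : Type*}

/-- `t` maximizes the score `f` over the set `N`, ties being broken by the labels `e`. -/
def IsWinner (e : V → ℕ) (N : Set V) (f : V → ℝ) (t : V) : Prop :=
  t ∈ N ∧ ∀ s ∈ N, f s < f t ∨ f s = f t ∧ e s ≤ e t

theorem exists_isWinner [Finite V] (e : V → ℕ) {N : Set V} (hN : N.Nonempty) (f : V → ℝ) :
    ∃ t, IsWinner e N f t := by
  obtain ⟨t, ht, hmax⟩ := Set.exists_max_image N (fun s => toLex (f s, e s)) N.toFinite hN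
  exact ⟨t, ht, fun s hs => Prod.Lex.toLex_le_toLex.1 (hmax s hs)⟩

variable {e : V → ℕ} {N : Set V} {f g : V → ℝ} {s t : V}

theorem IsWinner.le (h : IsWinner e N f t) (hs : s ∈ N) : f s ≤ f t :=
  (h.2 s hs).elim le_of_lt fun h => h.1.le

theorem IsWinner.eq (he : Function.Injective e) (hs : IsWinner e N f s)
    (ht : IsWinner e N f t) : s = t := by
  have hst : f s = f t := le_antisymm (ht.le hs.1) (hs.le ht.1)
  refine he (le_antisymm ?_ ?_)
  · exact (ht.2 s hs.1).elim (fun h => absurd hst h.ne) fun h => h.2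
  · exact (hs.2 t ht.1).elim (fun h => absurd hst.symm h.ne) fun h => h.2

theorem IsWinner.of_sub_le (h : IsWinner e N f t) (hfg : ∀ s, g s - g t ≤ f s - f t) :
    IsWinner e N g t := by
  refine ⟨h.1, fun s hs => ?_⟩
  have := hfg s
  rcases h.2 s hs with h1 | ⟨h1, h2⟩
  · exact Or.inl (by linarith)
  · rcases (show g s ≤ g t by linarith).lt_or_eq with h3 | h3
    · exact Or.inl h3
    · exact Or.inr ⟨h3, h2⟩

end Winner

section Clustering

variable {V : Type*} {w : Sym2 V → ℝ} {G : SimpleGraph V}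

/-- The score given to the centre `t` by the vertex `x`: the random shift of `t`, in multiples of
`h`, minus the distance from `t` to `x`. -/
noncomputable def shiftedScore (w : Sym2 V → ℝ) (G : SimpleGraph V) (h : ℝ) {K : ℕ}
    (ω : V → Fin K) (x t : V) : ℝ :=
  h * (ω t : ℕ) - wdist w G t x

/-- The partition into the fibres of a map. -/
def Partition.ofMap {α : Type*} (f : V → α) : Partition V where
  cl x := {y | f y = f x}
  mem_cl _ := rfl
  cl_eq u v h := by
    ext y
    simp only [Set.mem_ofPred_eq] at h ⊢
    rw [h]

theorem Partition.ofMap_cl_eq {α : Type*} {f : V → α} {u v : V} (h : f u = f v) :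
    (Partition.ofMap f).cl u = (Partition.ofMap f).cl v :=
  (Partition.ofMap f).cl_eq u v h

/-- The clusters of shifted-distance clustering have small strong diameter. -/
theorem stronglyBounded_ofMap_winner [Finite V] (hG : G.Connected) (hw : ∀ e, 0 ≤ w e)
    {e : V → ℕ} (he : Function.Injective e) {N : Set V} {h R : ℝ} {K : ℕ} {ω : V → Fin K}
    {win : V → V} (hwin : ∀ x, IsWinner e N (shiftedScore w G h ω x) (win x))
    (hR : ∀ x, wdist w G (win x) x ≤ R) :
    (Partition.ofMap win).StronglyBounded w G (2 * R) := by
  intro v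
  refine StronglyBounded.of_center hG hw (t := win v) (fun x hx => ?_) fun x hx y hy => ?_
  · rw [wdist_comm]
    have hx' : win x = win v := hx
    exact hx' ▸ hR x
  · have hx' : win x = win v := hx
    refine ((hx' ▸ hwin x).of_sub_le fun s => ?_).eq he (hwin y) |>.symm
    have h1 := wdist_triangle hG hw s y x
    rw [wdist_comm x y, wdist_comm y (win v), wdist_comm x (win v)] at hy
    simp only [shiftedScore]
    linarith

variable {e : V → ℕ} {N : Set V} {h : ℝ} {K : ℕ} {win : (V → Fin K) → V → V}

theorem wdist_winner_le (hh : 0 ≤ h)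
    {ω : V → Fin K} {x t : V} (hwin : IsWinner e N (shiftedScore w G h ω x) t) {r : ℝ}
    (hN : ∃ s ∈ N, wdist w G s x ≤ r) : wdist w G t x ≤ h * K + r := by
  obtain ⟨s, hs, hsx⟩ := hN
  have h1 := hwin.le hs
  simp only [shiftedScore] at h1
  have h2 : h * (ω t : ℕ) ≤ h * K := by
    gcongr
    exact (ω t).2.le
  have h3 : 0 ≤ h * (ω s : ℕ) := by positivity
  linarith

/-- Raising the shift of the winning centre does not change the winner. -/
theorem winner_update_of_le [DecidableEq V] (he : Function.Injective e) (hh : 0 ≤ h)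
    (hwin : ∀ ω x, IsWinner e N (shiftedScore w G h ω x) (win ω x)) (x : V) (ω : V → Fin K)
    {i : Fin K} (hi : ω (win ω x) ≤ i) :
    win (Function.update ω (win ω x) i) x = win ω x := by
  refine (hwin _ x).eq he ((hwin ω x).of_sub_le fun s => ?_)
  have h1 : h * (ω (win ω x) : ℕ) ≤ h * (i : ℕ) := by
    gcongr
    exact hi
  by_cases hs : s = win ω x
  · rw [hs]; simp
  · simp only [shiftedScore, Function.update_self, Function.update_of_ne hs]
    linarith

/-- If two vertices choose different centres, then the winner at the first loses once its shift
is lowered by more than twice their distance. -/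
theorem winner_update_ne [DecidableEq V] [Finite V] (hG : G.Connected) (hw : ∀ e, 0 ≤ w e)
    (hh : 0 ≤ h) (hwin : ∀ ω x, IsWinner e N (shiftedScore w G h ω x) (win ω x))
    {ω : V → Fin K} {u v : V} (huv : win ω u ≠ win ω v) {m : ℕ}
    (hm : 2 * wdist w G u v < h * m) {i : Fin K} (hi : (i : ℕ) + m ≤ ω (win ω u)) :
    win (Function.update ω (win ω u) i) u ≠ win ω u := by
  intro heq
  have h1 := heq ▸ (hwin (Function.update ω (win ω u) i) u)
  have h2 := h1.le (hwin ω v).1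
  have h3 := (hwin ω v).le (hwin ω u).1
  simp only [shiftedScore, Function.update_self, Function.update_of_ne huv.symm] at h2 h3
  have h4 := wdist_triangle hG hw (win ω u) u v
  have h5 := wdist_triangle hG hw (win ω v) v u
  rw [wdist_comm v u] at h5
  have h6 : h * (i : ℕ) + h * m ≤ h * (ω (win ω u) : ℕ) := by
    rw [← mul_add]
    gcongr
    exact_mod_cast hi
  linarith

theorem winner_eq_of_wdist_eq_zero [Finite V] (hG : G.Connected) (hw : ∀ e, 0 ≤ w e)
    (he : Function.Injective e)
    (hwin : ∀ ω x, IsWinner e N (shiftedScore w G h ω x) (win ω x))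
    (ω : V → Fin K) {u v : V} (huv : wdist w G u v = 0) : win ω u = win ω v := by
  refine IsWinner.eq he ((hwin ω u).of_sub_le fun s => ?_) (hwin ω v)
  have h1 := wdist_triangle hG hw (win ω u) u v
  have h2 := wdist_triangle hG hw s v u
  rw [wdist_comm v u] at h2
  simp only [shiftedScore]
  linarith

open Classical in
/-- The separation probability of shifted-distance clustering with truncated geometric shifts. -/
theorem sum_separated_le [Fintype V] (hG : G.Connected) (hw : ∀ e, 0 ≤ w e)
    (he : Function.Injective e)
    (hwin : ∀ ω x, IsWinner e N (shiftedScore w G h ω x) (win ω x)) (hh : 0 < h)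
    {a : ℝ} (ha : 1 ≤ a) (hK : 2 * a < K) {r : ℝ}
    (hN : ∀ x, ∃ s ∈ N, wdist w G s x ≤ r) {u v : V}
    (hcard : ((N ∩ ball w G u (h * K + r)).ncard : ℝ) ≤ 2 ^ (2 * a))
    (hd : 0 < wdist w G u v → h ≤ wdist w G u v) :
    ∑ ω with win ω u ≠ win ω v, ∏ j, truncGeom (1 - 2 * a / K) K (ω j) ≤
      18 * a * wdist w G u v / (h * K) := by
  rcases (wdist_nonneg (G := G) hw u v).eq_or_lt with h0 | hpos
  · rw [Finset.filter_false_of_mem fun ω _ =>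
      not_not.2 (winner_eq_of_wdist_eq_zero hG hw he hwin ω h0.symm), ← h0]
    simp
  have hK0 : (0 : ℝ) < K := by linarith
  have hx0 : 0 < 2 * a / K := by positivity
  have hx1 : 2 * a / K < 1 := (div_lt_one hK0).2 hK
  have hdh := hd hpos
  set d := wdist w G u v
  set m : ℕ := ⌊2 * d / h⌋₊ + 1 with hm
  have hm1 : 2 * d < h * m := by
    rw [mul_comm h, ← div_lt_iff₀ hh, hm]
    exact_mod_cast Nat.lt_floor_add_one (2 * d / h)
  have hm2 : (m : ℝ) ≤ 3 * d / h := by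
    have h1 : (⌊2 * d / h⌋₊ : ℝ) ≤ 2 * d / h := Nat.floor_le (by positivity)
    have h2 : 1 ≤ d / h := (one_le_div hh).2 hdh
    have h3 : 3 * d / h = 2 * d / h + d / h := by ring
    rw [hm, h3]
    push_cast
    linarith
  have hfrag := sum_fragile_winner_le (q := 1 - 2 * a / K) (by linarith) (by linarith)
    (show 0 < K by exact_mod_cast hK0) (fun ω => win ω u)
    (fun ω i hi => winner_update_of_le he hh.le hwin u ω hi)
    (N ∩ ball w G u (h * K + r)).toFinset
    (fun ω => Set.mem_toFinset.2 ⟨(hwin ω u).1, by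
      change wdist w G u _ ≤ _
      rw [wdist_comm]
      exact wdist_winner_le hh.le (hwin ω u) (hN u)⟩) m
  rw [← Set.ncard_eq_toFinset_card'] at hfrag
  have herr := truncation_error_le ha hK hcard
  refine (Finset.sum_le_sum_of_subset_of_nonneg ?_ fun ω _ _ =>
    Finset.prod_nonneg fun j _ => truncGeom_nonneg (by linarith) _).trans (hfrag.trans ?_)
  · intro ω
    simp only [Finset.mem_filter, Finset.mem_univ, true_and]
    exact fun hω i hi => winner_update_ne hG hw hh.le hwin hω hm1 hi
  · calc _ ≤ (3 * d / h) * (3 * (2 * a / K)) := by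
          refine mul_le_mul hm2 (by linarith) ?_ (by positivity)
          have : 0 ≤ ∑ j : Fin K, (1 - 2 * a / K) ^ (j : ℕ) :=
            Finset.sum_nonneg fun _ _ => pow_nonneg (by linarith) _
          have h1 : 0 ≤ (1 - 2 * a / K) ^ K := pow_nonneg (by linarith) _
          have h2 : 0 ≤ 1 - (1 - 2 * a / K) := by linarith
          positivity
      _ = _ := by field_simp; ring

/-- For `K` large, the step `M / K` is below every positive distance. -/
theorem exists_step_le_wdist [Finite V] (w : Sym2 V → ℝ) (G : SimpleGraph V) (M b : ℝ) :
    ∃ K : ℕ, b < K ∧ ∀ u v, 0 < wdist w G u v → M / K ≤ wdist w G u v := by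
  have h1 : ∀ᶠ K : ℕ in Filter.atTop, ∀ p : V × V,
      0 < wdist w G p.1 p.2 → M / K ≤ wdist w G p.1 p.2 := by
    refine Filter.eventually_all.2 fun p => ?_
    by_cases hp : 0 < wdist w G p.1 p.2
    · filter_upwards [(tendsto_const_div_atTop_nhds_zero_nat M).eventually_le_const hp] with K hK _
      exact hK
    · exact Filter.Eventually.of_forall fun K h => absurd h hp
  obtain ⟨K, hK, hb⟩ := (h1.and (tendsto_natCast_atTop_atTop.eventually_gt_atTop b)).exists
  exact ⟨K, hb, fun u v => hK (u, v)⟩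

end Clustering

end Pad

/-- Graphs with doubling dimension `ddim` admit strongly
`(c·ddim, Δ)`-separating decompositions for every `Δ > 0`, for a universal constant `c > 0`. -/
theorem doubling_separating_decomposition :
    ∃ c : ℝ, 0 < c ∧
      ∀ (V : Type) [Fintype V], ∀ (G : SimpleGraph V), G.Connected →
      ∀ w : Sym2 V → ℝ, (∀ e, 0 ≤ w e) →
      ∀ ddim : ℝ, 1 ≤ ddim → Pad.Doubling w G ddim →
      ∀ Δ : ℝ, 0 < Δ →
      ∃ D : PMF (Pad.Partition V),
        (∀ P ∈ D.support, Pad.Partition.StronglyBounded w G P Δ) ∧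
        ∀ u v : V,
          D.toOuterMeasure {P | P.cl u ≠ P.cl v} ≤
            ENNReal.ofReal (c * ddim * Pad.wdist w G u v / Δ) := by
  classical
  refine ⟨72, by norm_num, fun V _ G hG w hw ddim hdim hdoub Δ hΔ => ?_⟩
  obtain ⟨N, hsep, hcov⟩ := Pad.exists_net (G := G) hw (r := 2 * (Δ / 8)) (by positivity)
  obtain ⟨K, hK, hstep⟩ := Pad.exists_step_le_wdist w G (Δ / 4) (2 * ddim)
  have hK0 : (0 : ℝ) < K := by linarith
  set h : ℝ := Δ / 4 / K with hh
  have hh0 : 0 < h := by positivity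
  have hhK : h * K = Δ / 4 := by rw [hh]; field_simp
  obtain ⟨e, he⟩ : ∃ e : V → ℕ, Function.Injective e :=
    ⟨fun x => Fintype.equivFin V x, fun x y hxy => by simpa [Fin.val_inj] using hxy⟩
  have hNne : N.Nonempty := by
    obtain ⟨x⟩ := hG.nonempty
    obtain ⟨t, ht, -⟩ := hcov x
    exact ⟨t, ht⟩
  choose win hwin using fun (ω : V → Fin K) (x : V) =>
    Pad.exists_isWinner e hNne (Pad.shiftedScore w G h ω x)
  have hq : 0 < 1 - 2 * ddim / K := by
    have := (div_lt_one hK0).2 hK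
    linarith
  have hW0 : ∀ ω : V → Fin K, 0 ≤ ∏ j, Pad.truncGeom (1 - 2 * ddim / K) K (ω j) :=
    fun ω => Finset.prod_nonneg fun j _ => Pad.truncGeom_nonneg hq _
  let μ : PMF (V → Fin K) := PMF.ofFintype
    (fun ω => ENNReal.ofReal (∏ j, Pad.truncGeom (1 - 2 * ddim / K) K (ω j))) (by
      rw [← ENNReal.ofReal_sum_of_nonneg fun ω _ => hW0 ω,
        Pad.sum_prod_eq_one (Pad.sum_truncGeom hq (by exact_mod_cast hK0)), ENNReal.ofReal_one])
  refine ⟨μ.map fun ω => Pad.Partition.ofMap (win ω), ?_, fun u v => ?_⟩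
  · intro P hP
    obtain ⟨ω, -, rfl⟩ := (PMF.mem_support_map_iff _ _ _).1 hP
    have := Pad.stronglyBounded_ofMap_winner hG hw he (hwin ω)
      fun x => Pad.wdist_winner_le hh0.le (hwin ω x) (hcov x)
    rwa [hhK, show 2 * (Δ / 4 + 2 * (Δ / 8)) = Δ by ring] at this
  · have hcard := hdoub.ncard_separated_le hG hw (by positivity : 0 < Δ / 8) hsep u
    rw [show 4 * (Δ / 8) = h * K + 2 * (Δ / 8) by rw [hhK]; ring] at hcard
    have hbound := Pad.sum_separated_le hG hw he hwin hh0 hdim hK hcov hcard (hstep u v)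
    rw [hhK, show 18 * ddim * Pad.wdist w G u v / (Δ / 4) =
      72 * ddim * Pad.wdist w G u v / Δ by field_simp; ring] at hbound
    rw [PMF.toOuterMeasure_map_apply]
    calc _ ≤ μ.toOuterMeasure {ω | win ω u ≠ win ω v} :=
          μ.toOuterMeasure.mono fun ω (hω : (Pad.Partition.ofMap (win ω)).cl u ≠ _) hne =>
            hω (Pad.Partition.ofMap_cl_eq hne)
      _ = ENNReal.ofReal (∑ ω with win ω u ≠ win ω v,
            ∏ j, Pad.truncGeom (1 - 2 * ddim / K) K (ω j)) := by
          rw [PMF.toOuterMeasure_apply_fintype,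
            ENNReal.ofReal_sum_of_nonneg fun ω _ => hW0 ω, Finset.sum_filter]
          exact Finset.sum_congr rfl fun ω _ => by
            simp [Set.indicator_apply, μ, PMF.ofFintype_apply]
      _ ≤ _ := ENNReal.ofReal_le_ofReal hbound
end

section
/- Let (X, d) be a metric space, N ⊆ X a nonempty finite subset, x ∈ N and R ≥ 0, and define the cone C = {v ∈ X : d(v, x) − d(v, N) ≤ R}, where d(v, N) = min_{y ∈ N} d(v, y). Let v ∈ X, let x_v ∈ N be a closest point of N to v (d(v, x_v) = d(v, N)), and let u ∈ X satisfy d(v, u) + d(u, x_v) = d(v, x_v). If u ∈ C, then v ∈ C. -/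
open MeasureTheory

/-- In a metric space, the cone `C = {v | d(v,x) - d(v,N) ≤ R}` around a
center `x ∈ N` is closed under moving to a vertex `v` from a point `u` lying on a geodesic from
`v` to a closest point `x_v ∈ N` of `v`. -/
theorem cone_closed_under_shortest_path
    (X : Type) [MetricSpace X] (N : Set X) (hfin : N.Finite) (hne : N.Nonempty)
    (x : X) (hx : x ∈ N) (R : ℝ) (hR : 0 ≤ R)
    (C : Set X) (hC : C = {y | dist y x - Metric.infDist y N ≤ R})
    (v : X) (xv : X) (hxv : xv ∈ N) (hclosest : dist v xv = Metric.infDist v N)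
    (u : X) (hu : dist v u + dist u xv = dist v xv)
    (huC : u ∈ C) :
    v ∈ C := by
  subst hC
  have hu_le : Metric.infDist u N ≤ dist u xv := Metric.infDist_le_dist_of_mem hxv
  simp only [Set.mem_ofPred_eq] at huC ⊢
  linarith [dist_triangle v u x]
end
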